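/- Let n ≥ 4, d ≥ 1 and s ≥ 0 be integers with C(d+n,n) ≤ C(d+2,2) + s(d+1). Then there exist linear forms a, b, c and l_1, m_1, …, l_s, m_s in T = ℂ[y_0,…,y_n] such that every homogeneous polynomial f ∈ T of degree d can be written as f = f_1(l_1,m_1) + ⋯ + f_s(l_s,m_s) + g(a,b,c), where each f_i is a binary form of degree d and g is a ternary form of degree d; equivalently, the degree-d component T_d equals the sum of the degree-d components of the subalgebras ℂ[l_1,m_1], …, ℂ[l_s,m_s] and ℂ[a,b,c] of T. -/

import Mathlib

open MvPolynomial

set_option autoImplicit false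
namespace PL
open Module Submodule
open scoped Polynomial

section curves
variable {R : Type*} [CommRing R] [Algebra ℂ R]

/-- A family of subspaces spanned by finitely many polynomial curves. -/
def PF (A : ℂ → Submodule ℂ R) : Prop :=
  ∃ s : Set R[X], s.Finite ∧ ∀ τ, A τ = span ℂ ((fun p : R[X] => p.eval (algebraMap ℂ R τ)) '' s)

/-- A polynomial curve. -/
def PC (u : ℂ → R) : Prop := ∃ p : R[X], ∀ τ, u τ = p.eval (algebraMap ℂ R τ)

lemma PC.const (u : R) : PC (fun _ => u) := ⟨Polynomial.C u, by simp⟩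

lemma PC.add {u v : ℂ → R} (hu : PC u) (hv : PC v) : PC (fun τ => u τ + v τ) := by
  obtain ⟨p, hp⟩ := hu
  obtain ⟨q, hq⟩ := hv
  exact ⟨p + q, fun τ => by simp [hp, hq]⟩

lemma PC.mul {u v : ℂ → R} (hu : PC u) (hv : PC v) : PC (fun τ => u τ * v τ) := by
  obtain ⟨p, hp⟩ := hu
  obtain ⟨q, hq⟩ := hv
  exact ⟨p * q, fun τ => by simp [hp, hq]⟩

lemma PC.pow {u : ℂ → R} (hu : PC u) (n : ℕ) : PC (fun τ => u τ ^ n) := by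
  obtain ⟨p, hp⟩ := hu
  exact ⟨p ^ n, fun τ => by simp [hp]⟩

lemma PC.sum {ι : Type*} (s : Finset ι) {u : ι → ℂ → R} (hu : ∀ i ∈ s, PC (u i)) :
    PC (fun τ => ∑ i ∈ s, u i τ) := by
  classical
  induction s using Finset.induction_on with
  | empty => simpa using PC.const (0 : R)
  | insert a s ha ih =>
    simp only [Finset.sum_insert ha]
    exact (hu a (by simp)).add (ih fun i hi => hu i (by simp [hi]))

lemma PC.line (x y : R) : PC (fun τ : ℂ => x + τ • y) :=
  ⟨Polynomial.C x + Polynomial.X * Polynomial.C y, fun τ => by simp [Algebra.smul_def]; exact mul_comm _ _⟩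

lemma PC.smul {c : ℂ → ℂ} {u : ℂ → R} (hc : PC c) (hu : PC u) : PC (fun τ => c τ • u τ) := by
  obtain ⟨p, hp⟩ := hc
  obtain ⟨q, hq⟩ := hu
  refine ⟨p.map (algebraMap ℂ R) * q, fun τ => ?_⟩
  simp [hp, hq, Algebra.smul_def, Polynomial.eval_map_algebraMap, Polynomial.aeval_algebraMap_apply]

lemma PF.singleton {u : ℂ → R} (hu : PC u) : PF (fun τ => span ℂ {u τ}) := by
  obtain ⟨p, hp⟩ := hu
  exact ⟨{p}, Set.finite_singleton _, fun τ => by simp [hp]⟩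

lemma PF.sup {A B : ℂ → Submodule ℂ R} (hA : PF A) (hB : PF B) : PF (fun τ => A τ ⊔ B τ) := by
  obtain ⟨s, hs, h⟩ := hA
  obtain ⟨t, ht, h'⟩ := hB
  exact ⟨s ∪ t, hs.union ht, fun τ => by beta_reduce; rw [h, h', Set.image_union, span_union]⟩

lemma PF.mul {A B : ℂ → Submodule ℂ R} (hA : PF A) (hB : PF B) : PF (fun τ => A τ * B τ) := by
  obtain ⟨s, hs, h⟩ := hA
  obtain ⟨t, ht, h'⟩ := hB
  refine ⟨Set.image2 (· * ·) s t, hs.image2 _ ht, fun τ => ?_⟩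
  beta_reduce
  rw [h, h', span_mul_span, ← Set.image2_mul, Set.image_image2, Set.image2_image_left,
    Set.image2_image_right]
  simp

lemma PF.one : PF (fun _ => (1 : Submodule ℂ R)) :=
  ⟨{1}, Set.finite_singleton _, fun τ => by simp [Submodule.one_eq_span]⟩

lemma PF.pow {A : ℂ → Submodule ℂ R} (hA : PF A) (n : ℕ) : PF (fun τ => A τ ^ n) := by
  induction n with
  | zero => simpa using PF.one
  | succ n ih => simpa [pow_succ] using ih.mul hA

lemma PF.bot : PF (fun _ => (⊥ : Submodule ℂ R)) := ⟨∅, Set.finite_empty, by simp⟩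

lemma PF.iSup {ι : Type*} [Finite ι] {A : ι → ℂ → Submodule ℂ R} (hA : ∀ i, PF (A i)) :
    PF (fun τ => ⨆ i, A i τ) := by
  choose s hs h using hA
  refine ⟨⋃ i, s i, Set.finite_iUnion hs, fun τ => ?_⟩
  simp [Set.image_iUnion, span_iUnion, h]

lemma PF.pair {u v : ℂ → R} (hu : PC u) (hv : PC v) : PF (fun τ => span ℂ {u τ, v τ}) := by
  simp_rw [span_insert]
  exact (PF.singleton hu).sup (PF.singleton hv)

lemma PF.triple {u v w : ℂ → R} (hu : PC u) (hv : PC v) (hw : PC w) :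
    PF (fun τ => span ℂ {u τ, v τ, w τ}) := by
  simp_rw [span_insert _ {_, _}]
  exact (PF.singleton hu).sup (PF.pair hv hw)

lemma PF.fd {A : ℂ → Submodule ℂ R} (hA : PF A) (τ : ℂ) : FiniteDimensional ℂ (A τ) := by
  obtain ⟨s, hs, h⟩ := hA
  rw [h]
  exact FiniteDimensional.span_of_finite ℂ (hs.image _)

/-- Semicontinuity of the rank. -/
lemma PF.semicont {A : ℂ → Submodule ℂ R} (hA : PF A) {τ₀ : ℂ} {r : ℕ}
    (h0 : r ≤ finrank ℂ (A τ₀)) : {τ | ¬ r ≤ finrank ℂ (A τ)}.Finite := by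
  classical
  have hfd := hA.fd
  obtain ⟨s, hs, h⟩ := hA
  -- choose independent elements
  obtain ⟨f, hfs, hli⟩ : ∃ f : Fin r → R[X], (∀ i, f i ∈ s) ∧
      LinearIndependent ℂ (fun i => (f i).eval (algebraMap ℂ R τ₀)) := by
    obtain ⟨b, hb, hsp, hbl⟩ := exists_linearIndependent ℂ
      ((fun p : R[X] => p.eval (algebraMap ℂ R τ₀)) '' s)
    have hbf : b.Finite := (hs.image _).subset hb
    have := hbf.fintype
    have hc : r ≤ Fintype.card b := by
      rw [h, ← hsp] at h0
      have := finrank_span_eq_card hbl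
      rw [Subtype.range_coe] at this
      rwa [this] at h0
    have hc' : Fintype.card (Fin r) ≤ Fintype.card b := by simpa using hc
    obtain ⟨e⟩ := Function.Embedding.nonempty_of_card_le hc'
    have : ∀ i : Fin r, ∃ p ∈ s, p.eval (algebraMap ℂ R τ₀) = (e i : R) := fun i => hb (e i).2
    choose f hf hf' using this
    refine ⟨f, hf, ?_⟩
    simp_rw [hf']
    exact hbl.comp e e.injective
  obtain ⟨g, hg⟩ := LinearMap.exists_leftInverse_of_injective
    (Finsupp.linearCombination ℂ (fun i => (f i).eval (algebraMap ℂ R τ₀)))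
    (LinearMap.ker_eq_bot.2 hli)
  let P : Matrix (Fin r) (Fin r) ℂ[X] := fun i j =>
    ∑ k ∈ Finset.range ((f i).natDegree + 1), Polynomial.C (g ((f i).coeff k) j) * Polynomial.X ^ k
  have hP : ∀ τ i j, (P i j).eval τ = g ((f i).eval (algebraMap ℂ R τ)) j := by
    intro τ i j
    simp only [P, Polynomial.eval_finsetSum, Polynomial.eval_mul, Polynomial.eval_C,
      Polynomial.eval_pow, Polynomial.eval_X]
    rw [Polynomial.eval_eq_sum_range, map_sum, Finsupp.finsetSum_apply]
    refine Finset.sum_congr rfl fun k _ => ?_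
    rw [← map_pow, mul_comm _ (algebraMap ℂ R _), ← Algebra.smul_def, map_smul]
    simp [mul_comm]
  have hdet : ∀ τ, P.det.eval τ = (Matrix.of fun i j => g ((f i).eval (algebraMap ℂ R τ)) j).det := by
    intro τ
    rw [← Polynomial.coe_evalRingHom, RingHom.map_det]
    congr 1
    ext i j
    simp [hP]
  have h1 : P.det ≠ 0 := by
    intro h0
    have := hdet τ₀
    rw [h0] at this
    have h2 : (Matrix.of fun i j => g ((f i).eval (algebraMap ℂ R τ₀)) j) = (1 : Matrix (Fin r) (Fin r) ℂ) := by
      ext i j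
      have := congrArg (fun l => l (Finsupp.single i 1) j) hg
      simp only [LinearMap.comp_apply, Finsupp.linearCombination_single, one_smul,
        LinearMap.id_apply] at this
      simp only [Matrix.of_apply, this, Matrix.one_apply, Finsupp.single_apply]
    rw [h2] at this
    simp at this
  refine (P.det.roots.toFinset.finite_toSet).subset fun τ hτ => ?_
  simp only [Finset.mem_coe, Multiset.mem_toFinset, Polynomial.mem_roots h1, Polynomial.IsRoot]
  by_contra hne
  apply hτ
  rw [hdet] at hne
  have hrow := Matrix.linearIndependent_rows_of_det_ne_zero hne
  have hli2 : LinearIndependent ℂ (fun i => (f i).eval (algebraMap ℂ R τ)) := by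
    have hl : LinearIndependent ℂ ((Finsupp.lcoeFun.comp g) ∘
        (fun i => (f i).eval (algebraMap ℂ R τ))) := by
      exact hrow
    exact LinearIndependent.of_comp _ hl
  have hsub : span ℂ (Set.range fun i => (f i).eval (algebraMap ℂ R τ)) ≤ A τ := by
    rw [h, span_le]
    rintro _ ⟨i, rfl⟩
    exact subset_span ⟨f i, hfs i, rfl⟩
  have := hfd τ
  have := finrank_mono hsub
  rw [finrank_span_eq_card hli2] at this
  simpa using this

end curves

section zariski
variable {Ω Ω' : Type*} [AddCommGroup Ω] [Module ℂ Ω] [AddCommGroup Ω'] [Module ℂ Ω']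

/-- Sets that are cofinite along lines as soon as they are non-empty there. -/
def Zo (S : Set Ω) : Prop := ∀ x ∈ S, ∀ y, {τ : ℂ | x + τ • (y - x) ∉ S}.Finite

lemma Zo.inter_nonempty {S S' : Set Ω} (h : Zo S) (h' : Zo S') (hS : S.Nonempty)
    (hS' : S'.Nonempty) : (S ∩ S').Nonempty := by
  obtain ⟨x, hx⟩ := hS
  obtain ⟨y, hy⟩ := hS'
  have h1 := h x hx y
  have h2 := h' y hy x
  have h3 : ((fun τ : ℂ => 1 - τ) ⁻¹' {τ : ℂ | y + τ • (x - y) ∉ S'}).Finite :=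
    h2.preimage (fun a _ b _ hab => by simpa using hab)
  obtain ⟨τ, hτ⟩ := ((h1.union h3).infinite_compl).nonempty
  simp only [Set.mem_compl_iff, Set.mem_union, Set.mem_ofPred_eq, Set.mem_preimage, not_or,
    not_not] at hτ
  refine ⟨_, hτ.1, ?_⟩
  convert hτ.2 using 1
  module

lemma Zo.inter {S S' : Set Ω} (h : Zo S) (h' : Zo S') : Zo (S ∩ S') := by
  rintro x ⟨hx, hx'⟩ y
  refine ((h x hx y).union (h' x hx' y)).subset fun τ hτ => ?_
  simp only [Set.mem_ofPred_eq, Set.mem_inter_iff, not_and_or] at hτ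
  exact hτ

lemma Zo.preimage {S : Set Ω} (h : Zo S) (f : Ω' →ₗ[ℂ] Ω) : Zo (f ⁻¹' S) := by
  intro x hx y
  refine (h (f x) hx (f y)).subset fun τ hτ => ?_
  simpa using hτ

lemma Zo.of_PF {R : Type*} [CommRing R] [Algebra ℂ R] {A : Ω → Submodule ℂ R} (r : ℕ)
    (h : ∀ x y, PF (fun τ => A (x + τ • (y - x)))) : Zo {ω | r ≤ finrank ℂ (A ω)} := by
  intro x hx y
  exact (h x y).semicont (τ₀ := 0) (by
    have e : x + (0:ℂ) • (y - x) = x := by simp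
    rw [e]; exact hx)

lemma Zo.ne_zero {f : Ω → ℂ} (h : ∀ x y, PC (fun τ => f (x + τ • (y - x)))) :
    Zo {ω | f ω ≠ 0} := by
  intro x hx y
  obtain ⟨p, hp⟩ := h x y
  have h1 : p ≠ 0 := by
    rintro rfl
    have := hp 0
    simp at this
    exact hx this
  refine (p.roots.toFinset.finite_toSet).subset fun τ hτ => ?_
  simp only [Set.mem_ofPred_eq, not_not, hp] at hτ
  simpa [Polynomial.mem_roots h1] using hτ

lemma Zo.forall_ne_zero {ι : Type*} [Finite ι] {f : ι → Ω → ℂ}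
    (h : ∀ i x y, PC (fun τ => f i (x + τ • (y - x)))) :
    Zo {ω | ∀ i, f i ω ≠ 0} := by
  intro x hx y
  refine (Set.finite_iUnion fun i => Zo.ne_zero (h i) x (hx i) y).subset fun τ hτ => ?_
  simpa using hτ

end zariski

section linalg
variable {R : Type*} [AddCommGroup R] [Module ℂ R] {R' : Type*} [AddCommGroup R'] [Module ℂ R']

lemma rank_step (D : R →ₗ[ℂ] R') {A : Submodule ℂ R} [FiniteDimensional ℂ A]
    {Res : Submodule ℂ R'} {Tr : Submodule ℂ R}
    (h1 : Res ≤ A.map D) (h2 : Tr ≤ A) (h3 : Tr ≤ LinearMap.ker D) :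
    finrank ℂ Res + finrank ℂ Tr ≤ finrank ℂ A := by
  have h := LinearMap.finrank_range_add_finrank_ker (D.domRestrict A)
  rw [LinearMap.range_domRestrict] at h
  have e1 : finrank ℂ Res ≤ finrank ℂ (A.map D) := finrank_mono h1
  have e2 : finrank ℂ Tr ≤ finrank ℂ (LinearMap.ker (D.domRestrict A)) := by
    have : Tr ≤ (LinearMap.ker (D.domRestrict A)).map A.subtype := by
      intro x hx
      exact ⟨⟨x, h2 hx⟩, by simpa using h3 hx, rfl⟩
    have h4 := finrank_mono this
    rwa [finrank_map_subtype_eq] at h4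
  omega

lemma fill (A E : Submodule ℂ R) [FiniteDimensional ℂ A] [FiniteDimensional ℂ E] {ι : Type*} [Nonempty ι] (Y : ι → R)
    (h : E ≤ A ⊔ span ℂ (Set.range Y)) (k : ℕ) :
    ∃ y : Fin k → ι, min (finrank ℂ A + k) (finrank ℂ E) ≤
      finrank ℂ (A ⊔ ⨆ i, span ℂ {Y (y i)} : Submodule ℂ R) := by
  induction k with
  | zero => exact ⟨Fin.elim0, (min_le_left _ _).trans (finrank_mono le_sup_left)⟩
  | succ k ih =>
    obtain ⟨y, hy⟩ := ih
    set B : Submodule ℂ R := A ⊔ ⨆ i, span ℂ {Y (y i)} with hB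
    have : FiniteDimensional ℂ B := by rw [hB]; infer_instance
    by_cases hE : ∀ i, Y i ∈ B
    · have hEB : E ≤ B := h.trans (sup_le le_sup_left (span_le.2 (by rintro _ ⟨i, rfl⟩; exact hE i)))
      obtain ⟨i0⟩ := ‹Nonempty ι›
      refine ⟨Fin.snoc y i0, (min_le_right _ _).trans ((finrank_mono hEB).trans ?_)⟩
      refine finrank_mono (sup_le le_sup_left (iSup_le fun i => ?_))
      refine le_trans ?_ (le_sup_right (a := A))
      refine le_trans ?_ (le_iSup _ (Fin.castSucc i))
      simp
    · push Not at hE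
      obtain ⟨i0, hi0⟩ := hE
      refine ⟨Fin.snoc y i0, ?_⟩
      have hlt : B < A ⊔ ⨆ i, span ℂ {Y ((Fin.snoc y i0 : Fin (k+1) → ι) i)} := by
        refine lt_of_le_of_ne ?_ ?_
        · refine (sup_le le_sup_left (iSup_le fun i => ?_))
          refine le_trans ?_ (le_sup_right (a := A))
          refine le_trans ?_ (le_iSup _ (Fin.castSucc i))
          simp
        · intro heq
          apply hi0
          rw [heq]
          apply le_sup_right (a := A)
          refine (le_iSup (fun i => span ℂ {Y ((Fin.snoc y i0 : Fin (k+1) → ι) i)}) (Fin.last k)) ?_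
          simp
      have := finrank_lt_finrank_of_lt hlt
      omega
end linalg
end PL

set_option autoImplicit false
namespace PL
open Module Submodule
open scoped Polynomial Pointwise

section alg
variable {R : Type*} [CommRing R] [Algebra ℂ R]

/-- If a polynomial curve lies in a subspace, so do its coefficients. -/
lemma coeff_mem_of_eval_mem (W : Submodule ℂ R) (p : R[X])
    (h : Set.Infinite {τ : ℂ | p.eval (algebraMap ℂ R τ) ∈ W}) (k : ℕ) : p.coeff k ∈ W := by
  by_contra hk
  obtain ⟨φ, hφ, hle⟩ := Submodule.exists_le_ker_of_notMem hk
  let P : ℂ[X] := ∑ i ∈ Finset.range (p.natDegree + 1),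
    Polynomial.C (φ (p.coeff i)) * Polynomial.X ^ i
  have hP : ∀ τ, P.eval τ = φ (p.eval (algebraMap ℂ R τ)) := by
    intro τ
    simp only [P, Polynomial.eval_finsetSum, Polynomial.eval_mul, Polynomial.eval_C,
      Polynomial.eval_pow, Polynomial.eval_X]
    rw [Polynomial.eval_eq_sum_range, map_sum]
    refine Finset.sum_congr rfl fun k _ => ?_
    rw [← map_pow, mul_comm _ (algebraMap ℂ R _), ← Algebra.smul_def, map_smul]
    simp [mul_comm]
  have hP0 : P = 0 := by
    refine Polynomial.eq_zero_of_infinite_isRoot P (h.mono fun τ hτ => ?_)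
    have : φ (p.eval (algebraMap ℂ R τ)) = 0 := hle hτ
    simp [Polynomial.IsRoot, hP, this]
  have : P.coeff k = φ (p.coeff k) := by
    simp only [P, Polynomial.finsetSum_coeff, Polynomial.coeff_C_mul, Polynomial.coeff_X_pow]
    simp only [mul_ite, mul_one, mul_zero, Finset.sum_ite_eq, Finset.mem_range]
    split_ifs with hh
    · rfl
    · rw [Polynomial.coeff_eq_zero_of_natDegree_lt (by omega)]; simp
  rw [hP0] at this
  exact hφ (by simpa using this.symm)

lemma mul_pow_mem_span (W : Submodule ℂ R) (S : Submodule ℂ R) (d : ℕ)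
    (h : ∀ w ∈ W, w ^ (d+1) ∈ S) {x w : R} (hx : x ∈ W) (hw : w ∈ W) : x ^ d * w ∈ S := by
  have h1 := coeff_mem_of_eval_mem S ((Polynomial.C x + Polynomial.X * Polynomial.C w) ^ (d+1)) (by
    refine Set.infinite_univ.mono fun τ _ => ?_
    simp only [Set.mem_ofPred_eq, Polynomial.eval_pow, Polynomial.eval_add, Polynomial.eval_mul,
      Polynomial.eval_C, Polynomial.eval_X]
    refine h _ (W.add_mem hx ?_)
    rw [← Algebra.smul_def]
    exact W.smul_mem _ hw) 1
  have h2 : ((Polynomial.C x + Polynomial.X * Polynomial.C w) ^ (d+1)).coeff 1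
      = ((d:ℂ)+1) • (x ^ d * w) := by
    have h3 := Polynomial.coeff_derivative ((Polynomial.C x + Polynomial.X * Polynomial.C w) ^ (d+1)) 0
    rw [Polynomial.coeff_zero_eq_eval_zero] at h3
    simp [Polynomial.derivative_pow] at h3
    rw [mul_comm Polynomial.X, ← h3, Algebra.smul_def]
    simp
    ring
  rw [h2] at h1
  have := S.smul_mem ((d:ℂ)+1)⁻¹ h1
  rwa [smul_smul, inv_mul_cancel₀ (by exact_mod_cast Nat.succ_ne_zero d), one_smul] at this

lemma pow_eq_span (W : Submodule ℂ R) (d : ℕ) :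
    W ^ d = span ℂ ((fun w => w ^ d) '' (W : Set R)) := by
  apply le_antisymm
  · induction d with
    | zero =>
      rw [pow_zero, Submodule.one_eq_span]
      refine span_mono ?_
      rintro _ rfl
      exact ⟨0, W.zero_mem, by simp⟩
    | succ d ih =>
      rw [pow_succ]
      refine (mul_le_mul' ih (le_refl W)).trans ?_
      have e : span ℂ ((fun w => w ^ d) '' (W : Set R)) * W
          = span ℂ (((fun w => w ^ d) '' (W : Set R)) * (W : Set R)) := by
        rw [← span_mul_span, span_eq]
      rw [e, span_le]
      rintro _ ⟨_, ⟨x, hx, rfl⟩, w, hw, rfl⟩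
      exact mul_pow_mem_span W (span ℂ ((fun w => w ^ (d+1)) '' (W : Set R))) d
        (fun w hw => subset_span ⟨w, hw, rfl⟩) hx hw
  · rw [span_le]
    rintro _ ⟨w, hw, rfl⟩
    exact Submodule.pow_mem_pow _ hw _

/-- Powers of a two-dimensional space. -/
abbrev ln (d : ℕ) (x y : R) : Submodule ℂ R := (span ℂ {x, y}) ^ d
/-- Powers of a three-dimensional space. -/
abbrev pln (d : ℕ) (x y z : R) : Submodule ℂ R := (span ℂ {x, y, z}) ^ d

lemma fg_pow {W : Submodule ℂ R} (h : W.FG) (d : ℕ) : (W ^ d).FG := h.pow d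

instance instFd_ln (d : ℕ) (x y : R) : FiniteDimensional ℂ (ln d x y) :=
  Module.Finite.iff_fg.2 ((fg_span (by simp)).pow d)
instance instFd_pln (d : ℕ) (x y z : R) : FiniteDimensional ℂ (pln d x y z) :=
  Module.Finite.iff_fg.2 ((fg_span (by simp)).pow d)

lemma mem_ln {x y z : R} (d : ℕ) (h : z ∈ span ℂ {x, y}) : z ^ d ∈ ln d x y :=
  Submodule.pow_mem_pow _ h _
lemma left_mem_ln (d : ℕ) (x y : R) : x ^ d ∈ ln d x y := mem_ln d (subset_span (by simp))
lemma right_mem_ln (d : ℕ) (x y : R) : y ^ d ∈ ln d x y := mem_ln d (subset_span (by simp))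

lemma map_ln {R' : Type*} [CommRing R'] [Algebra ℂ R'] (f : R →ₐ[ℂ] R') (d : ℕ) (x y : R) :
    (ln d x y).map f.toLinearMap = ln d (f x) (f y) := by
  rw [ln, Submodule.map_pow, Submodule.map_span, Set.image_pair]; rfl

lemma finrank_map_inj {R' : Type*} [CommRing R'] [Algebra ℂ R'] (f : R →ₗ[ℂ] R')
    (hf : Function.Injective f) (W : Submodule ℂ R) : finrank ℂ (W.map f) = finrank ℂ W :=
  ((Submodule.equivMapOfInjective f hf W).finrank_eq).symm

lemma ln_comm (d : ℕ) (x y : R) : ln d x y = ln d y x := by rw [ln, Set.pair_comm]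

/-- Derivations -/
lemma deriv_pow_le (D : Derivation ℂ R R) (W : Submodule ℂ R) (hW : ∀ w ∈ W, D w ∈ (1 : Submodule ℂ R))
    (d : ℕ) : ∀ x ∈ W ^ (d+1), D x ∈ W ^ d := by
  induction d with
  | zero => simpa using hW
  | succ d ih =>
    intro x hx
    rw [pow_succ'] at hx
    refine Submodule.mul_induction_on hx ?_ ?_
    · intro w hw y hy
      rw [Derivation.leibniz, smul_eq_mul, smul_eq_mul]
      refine add_mem ?_ ?_
      · rw [pow_succ']; exact Submodule.mul_mem_mul hw (ih y hy)
      · rw [← mul_one (W ^ (d+1))]; exact Submodule.mul_mem_mul hy (hW w hw)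
    · intro a b ha hb
      rw [map_add]; exact add_mem ha hb

lemma le_map_deriv (D : Derivation ℂ R R) (W : Submodule ℂ R) (hW : ∀ w ∈ W, D w ∈ (1 : Submodule ℂ R))
    {q : R} (hq : q ∈ W) (hDq : D q = 1) (d : ℕ) :
    W ^ d ≤ (W ^ (d+1)).map (D : R →ₗ[ℂ] R) := by
  have key : ∀ d b, ∀ x ∈ W ^ d, q ^ b * x ∈ (W ^ (d + b + 1)).map (D : R →ₗ[ℂ] R) := by
    intro d
    induction d with
    | zero =>
      intro b x hx
      rw [pow_zero] at hx
      obtain ⟨c, rfl⟩ := Submodule.mem_one.1 hx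
      refine ⟨(c / ((b:ℂ)+1)) • q ^ (b+1), Submodule.smul_mem _ _ ?_, ?_⟩
      · have : 0 + b + 1 = b + 1 := by omega
        rw [this]
        exact Submodule.pow_mem_pow _ hq _
      · have hb : ((b:ℂ)+1) ≠ 0 := by exact_mod_cast Nat.succ_ne_zero b
        simp only [Derivation.coeFn_coe, map_smul, Derivation.leibniz_pow, hDq]
        simp only [Nat.add_sub_cancel, smul_eq_mul, mul_one]
        rw [← Nat.cast_smul_eq_nsmul ℂ, smul_smul]
        push_cast
        rw [div_mul_cancel₀ _ hb, Algebra.smul_def, mul_comm]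
    | succ d ih =>
      intro b x hx
      have hb : ((b:ℂ)+1) ≠ 0 := by exact_mod_cast Nat.succ_ne_zero b
      have h1 : q ^ (b+1) * D x ∈ (W ^ (d + 1 + b + 1)).map (D : R →ₗ[ℂ] R) := by
        have := ih (b+1) (D x) (deriv_pow_le D W hW d x hx)
        have e : d + (b+1) + 1 = d + 1 + b + 1 := by omega
        rwa [e] at this
      have h2 : D (q ^ (b+1) * x) ∈ (W ^ (d + 1 + b + 1)).map (D : R →ₗ[ℂ] R) := by
        refine ⟨_, ?_, rfl⟩
        have e : d + 1 + b + 1 = (b + 1) + (d + 1) := by omega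
        rw [e, pow_add]
        exact Submodule.mul_mem_mul (Submodule.pow_mem_pow _ hq _) hx
      have h3 := Submodule.smul_mem _ ((b:ℂ)+1)⁻¹ (sub_mem h2 h1)
      convert h3 using 1
      rw [Derivation.leibniz, Derivation.leibniz_pow, hDq]
      simp only [Nat.add_sub_cancel, smul_eq_mul, mul_one, add_sub_cancel_left]
      rw [← Nat.cast_smul_eq_nsmul ℂ, mul_smul_comm, smul_smul]
      push_cast
      rw [inv_mul_cancel₀ hb, one_smul, mul_comm]
  intro x hx
  simpa using key d 0 x hx

end alg

/-- Polynomial ring. -/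
abbrev T (n : ℕ) := MvPolynomial (Fin n) ℂ
/-- Vectors. -/
abbrev V (n : ℕ) := Fin n → ℂ
/-- The linear form with given coefficients. -/
noncomputable def lin (n : ℕ) : V n →ₗ[ℂ] T n := Fintype.linearCombination ℂ (X : Fin n → T n)
/-- Forms of degree d. -/
noncomputable abbrev Td (n d : ℕ) : Submodule ℂ (T n) := homogeneousSubmodule (Fin n) ℂ d

instance instFd_Td (n d : ℕ) : FiniteDimensional ℂ (Td n d) :=
  Module.Finite.iff_fg.2 (homogeneousSubmodule_fg _ _ _)

lemma lin_apply {n : ℕ} (u : V n) : lin n u = ∑ i, u i • X i := by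
  simp [lin, Fintype.linearCombination_apply]

lemma range_lin (n : ℕ) : LinearMap.range (lin n) = Td n 1 := by
  rw [lin, Fintype.range_linearCombination, Td, homogeneousSubmodule_one_eq_span_X]

lemma lin_mem {n : ℕ} (u : V n) : lin n u ∈ Td n 1 := by
  rw [← range_lin]; exact ⟨u, rfl⟩

lemma lin_hom {n : ℕ} (u : V n) : (lin n u).IsHomogeneous 1 := lin_mem u

lemma Td_eq_span (n d : ℕ) : Td n d = span ℂ (Set.range fun p : V n => lin n p ^ d) := by
  rw [Td, ← homogeneousSubmodule_one_pow, pow_eq_span]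
  congr 1
  have := range_lin n
  rw [Td] at this
  rw [← this]
  ext x
  simp

lemma pow_le_Td {n : ℕ} {W : Submodule ℂ (T n)} (h : W ≤ Td n 1) (d : ℕ) : W ^ d ≤ Td n d := by
  rw [Td, ← homogeneousSubmodule_one_pow]
  exact pow_le_pow_left' h d

lemma finrank_Td (n d : ℕ) : finrank ℂ (Td (n+1) d) = (d + n).choose n := by
  classical
  have h1 : Td (n+1) d = span ℂ (Set.range fun m : Finset.finsuppAntidiag (Finset.univ : Finset (Fin (n+1))) d =>
      (basisMonomials (Fin (n+1)) ℂ) m) := by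
    rw [Td, homogeneousSubmodule_eq_finsupp_supported, AddMonoidAlgebra.supported_eq_span_single]
    congr 1
    ext x
    simp [Finset.mem_finsuppAntidiag, Finsupp.degree_eq_sum]
    rfl
  rw [h1, finrank_span_eq_card]
  · rw [Fintype.card_coe, Finset.card_finsuppAntidiag_nat_eq_choose]
    simp only [Finset.card_univ, Fintype.card_fin]
    rw [show n + 1 + d - 1 = d + n by omega, ← Nat.choose_symm_add]
  · exact (basisMonomials (Fin (n+1)) ℂ).linearIndependent.comp _ Subtype.val_injective

lemma mem_span_range_pow {R : Type*} [CommRing R] [Algebra ℂ R] {k : ℕ} (g : Fin k → R) (d : ℕ) {f : R}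
    (h : f ∈ (span ℂ (Set.range g)) ^ d) :
    ∃ F : T k, F.IsHomogeneous d ∧ f = aeval g F := by
  have h1 : span ℂ (Set.range g) = (Td k 1).map (aeval g : T k →ₐ[ℂ] R).toLinearMap := by
    rw [Td, homogeneousSubmodule_one_eq_span_X, Submodule.map_span, ← Set.range_comp]
    congr 2
    ext i; simp
  rw [h1, ← Submodule.map_pow, Td, homogeneousSubmodule_one_pow] at h
  obtain ⟨F, hF, rfl⟩ := h
  exact ⟨F, hF, rfl⟩

/-- Inclusion of a hyperplane. -/
noncomputable abbrev io (n : ℕ) : T n →ₐ[ℂ] T (n+1) := rename Fin.castSucc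
/-- Derivative in the normal direction. -/
noncomputable abbrev Dl (n : ℕ) : Derivation ℂ (T (n+1)) (T (n+1)) := pderiv (Fin.last n)

lemma io_inj (n : ℕ) : Function.Injective (io n) := rename_injective _ (Fin.castSucc_injective n)

lemma Dl_io {n : ℕ} (f : T n) : Dl n (io n f) = 0 := by
  refine pderiv_eq_zero_of_notMem_vars ?_
  intro h
  have := vars_rename Fin.castSucc f h
  simp at this

lemma map_io_le (n d : ℕ) : (Td n d).map (io n).toLinearMap ≤ Td (n+1) d := by
  rintro _ ⟨f, hf, rfl⟩
  exact IsHomogeneous.rename_isHomogeneous hf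

lemma mem_map_io {n d : ℕ} {F : T (n+1)} (hF : F ∈ Td (n+1) d) (h : Dl n F = 0) :
    F ∈ (Td n d).map (io n).toLinearMap := by
  obtain ⟨q, rfl⟩ := exists_rename_eq_of_vars_subset_range F Fin.castSucc (Fin.castSucc_injective n) (by
    intro i hi
    by_contra hc
    have hil : i = Fin.last n := by
      by_contra hne
      exact hc ⟨i.castPred hne, by simp⟩
    subst hil
    rw [Finset.mem_coe, mem_vars_iff_mem_support] at hi
    obtain ⟨m, hm, hi⟩ := hi
    have h1 := coeff_pderiv (i := Fin.last n) F (m - Finsupp.single (Fin.last n) 1)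
    have h2 : pderiv (Fin.last n) F = 0 := h
    have h3 : m - Finsupp.single (Fin.last n) 1 + Finsupp.single (Fin.last n) 1 = m := by
      apply tsub_add_cancel_of_le
      rw [Finsupp.single_le_iff]
      have := Finsupp.mem_support_iff.1 hi
      omega
    rw [h3, h2, coeff_zero] at h1
    have h4 := mem_support_iff.1 hm
    rcases mul_eq_zero.1 h1.symm with h5 | h5
    · exact h4 h5
    · exact Nat.cast_add_one_ne_zero _ h5)
  exact ⟨q, (IsHomogeneous.rename_isHomogeneous_iff (Fin.castSucc_injective n)).1 hF, rfl⟩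

end PL

set_option autoImplicit false
namespace PL
open Module Submodule
open scoped Polynomial Pointwise

section param
variable {R : Type*} [CommRing R] [Algebra ℂ R] {Ω : Type*} [AddCommGroup Ω] [Module ℂ Ω]

/-- Functions polynomial along lines. -/
def PCo (f : Ω → R) : Prop := ∀ x y, PC (fun τ => f (x + τ • (y - x)))
/-- Families of subspaces polynomial along lines. -/
def PFo (A : Ω → Submodule ℂ R) : Prop := ∀ x y, PF (fun τ => A (x + τ • (y - x)))

lemma PCo.of_aff {f : Ω → R} (h : ∀ x y (τ : ℂ), f (x + τ • (y - x)) = f x + τ • (f y - f x)) :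
    PCo f := by
  intro x y
  simp_rw [h]
  exact PC.line _ _

lemma PCo.const (u : R) : PCo (fun _ : Ω => u) := fun _ _ => PC.const u
lemma PCo.add {f g : Ω → R} (hf : PCo f) (hg : PCo g) : PCo (fun ω => f ω + g ω) :=
  fun x y => (hf x y).add (hg x y)
lemma PCo.mul {f g : Ω → R} (hf : PCo f) (hg : PCo g) : PCo (fun ω => f ω * g ω) :=
  fun x y => (hf x y).mul (hg x y)
lemma PCo.pow {f : Ω → R} (hf : PCo f) (k : ℕ) : PCo (fun ω => f ω ^ k) :=
  fun x y => (hf x y).pow k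
lemma PFo.singleton {f : Ω → R} (hf : PCo f) : PFo (fun ω => span ℂ {f ω}) :=
  fun x y => PF.singleton (hf x y)
lemma PFo.ln {f g : Ω → R} (d : ℕ) (hf : PCo f) (hg : PCo g) : PFo (fun ω => ln d (f ω) (g ω)) :=
  fun x y => (PF.pair (hf x y) (hg x y)).pow d
lemma PFo.pln {f g h : Ω → R} (d : ℕ) (hf : PCo f) (hg : PCo g) (hh : PCo h) :
    PFo (fun ω => pln d (f ω) (g ω) (h ω)) :=
  fun x y => (PF.triple (hf x y) (hg x y) (hh x y)).pow d
lemma PFo.sup {A B : Ω → Submodule ℂ R} (hA : PFo A) (hB : PFo B) : PFo (fun ω => A ω ⊔ B ω) :=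
  fun x y => (hA x y).sup (hB x y)
lemma PFo.iSup {ι : Type*} [Finite ι] {A : ι → Ω → Submodule ℂ R} (hA : ∀ i, PFo (A i)) :
    PFo (fun ω => ⨆ i, A i ω) :=
  fun x y => PF.iSup fun i => hA i x y
lemma PFo.zo {A : Ω → Submodule ℂ R} (hA : PFo A) (r : ℕ) : Zo {ω | r ≤ finrank ℂ (A ω)} :=
  Zo.of_PF r hA

end param

/-- Linear form from a linear coordinate -/
lemma PCo.lin {Ω : Type*} [AddCommGroup Ω] [Module ℂ Ω] {n : ℕ} (f : Ω → V n)
    (h : ∀ x y (τ : ℂ), f (x + τ • (y - x)) = f x + τ • (f y - f x)) :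
    PCo (fun ω => lin n (f ω)) := PCo.of_aff fun x y τ => by rw [h]; simp

lemma PCo.iolin {Ω : Type*} [AddCommGroup Ω] [Module ℂ Ω] {n : ℕ} (f : Ω → V n)
    (h : ∀ x y (τ : ℂ), f (x + τ • (y - x)) = f x + τ • (f y - f x)) :
    PCo (fun ω => io n (PL.lin n (f ω))) := PCo.of_aff fun x y τ => by rw [h]; simp

/-- The normal coordinate. -/
noncomputable abbrev Xl (n : ℕ) : T (n+1) := X (Fin.last n)

lemma lin_snoc {n : ℕ} (p : V n) (c : ℂ) :
    lin (n+1) (Fin.snoc p c) = io n (lin n p) + c • Xl n := by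
  rw [lin_apply, Fin.sum_univ_castSucc, lin_apply, map_sum]
  simp

lemma lin_eq_snoc {n : ℕ} (u : V (n+1)) :
    lin (n+1) u = io n (lin n (Fin.init u)) + u (Fin.last n) • Xl n := by
  conv_lhs => rw [← Fin.snoc_init_self u]
  rw [lin_snoc]

lemma lin_snoc_zero {n : ℕ} (p : V n) : lin (n+1) (Fin.snoc p 0) = io n (lin n p) := by
  rw [lin_snoc]; simp

lemma lin_snoc_one {n : ℕ} (p : V n) : lin (n+1) (Fin.snoc p 1) = io n (lin n p) + Xl n := by
  rw [lin_snoc]; simp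

lemma Dl_Xl (n : ℕ) : Dl n (Xl n) = 1 := by simp

/-- Reduction of a vector modulo another one. -/
lemma nf_aux {n : ℕ} (W : V (n+1)) (hW : W (Fin.last n) ≠ 0) :
    ∃ w : V n, lin (n+1) W = W (Fin.last n) • (io n (lin n w) + Xl n) := by
  refine ⟨(W (Fin.last n))⁻¹ • Fin.init W, ?_⟩
  rw [lin_eq_snoc]
  simp only [map_smul, smul_add, smul_smul, mul_inv_cancel₀ hW, one_smul]

lemma nf_line {n : ℕ} (U W : V (n+1)) (hW : W (Fin.last n) ≠ 0) :
    ∃ p w : V n, span ℂ {lin (n+1) U, lin (n+1) W} ≤ span ℂ {io n (lin n p), io n (lin n w) + Xl n} := by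
  obtain ⟨w, hw⟩ := nf_aux W hW
  refine ⟨Fin.init U - U (Fin.last n) • w, w, ?_⟩
  rw [span_le]
  rintro x (rfl | rfl)
  · refine mem_span_pair.2 ⟨1, U (Fin.last n), ?_⟩
    rw [lin_eq_snoc U]
    simp only [map_sub, map_smul, smul_add, one_smul]
    abel
  · exact mem_span_pair.2 ⟨0, W (Fin.last n), by rw [hw]; simp⟩

lemma nf_plane {n : ℕ} (U U' W : V (n+1)) (hW : W (Fin.last n) ≠ 0) :
    ∃ p p' w : V n, span ℂ {lin (n+1) U, lin (n+1) U', lin (n+1) W} ≤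
      span ℂ {io n (lin n p), io n (lin n p'), io n (lin n w) + Xl n} := by
  obtain ⟨w, hw⟩ := nf_aux W hW
  refine ⟨Fin.init U - U (Fin.last n) • w, Fin.init U' - U' (Fin.last n) • w, w, ?_⟩
  rw [span_le]
  rintro x (rfl | rfl | rfl)
  · refine mem_span_triple.2 ⟨1, 0, U (Fin.last n), ?_⟩
    rw [lin_eq_snoc U]
    simp only [map_sub, map_smul, smul_add, one_smul, zero_smul]
    abel
  · refine mem_span_triple.2 ⟨0, 1, U' (Fin.last n), ?_⟩
    rw [lin_eq_snoc U']
    simp only [map_sub, map_smul, smul_add, one_smul, zero_smul]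
    abel
  · exact mem_span_triple.2 ⟨0, 0, W (Fin.last n), by rw [hw]; simp⟩

lemma mem_one_smul {R : Type*} [CommRing R] [Algebra ℂ R] (c : ℂ) : c • (1 : R) ∈ (1 : Submodule ℂ R) :=
  Submodule.smul_mem _ _ (Submodule.mem_one.2 ⟨1, by simp⟩)

lemma Dl_mem_one {n : ℕ} (s : Set (T (n+1))) (hs : ∀ x ∈ s, Dl n x ∈ (1 : Submodule ℂ (T (n+1)))) :
    ∀ w ∈ span ℂ s, Dl n w ∈ (1 : Submodule ℂ (T (n+1))) := by
  intro w hw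
  have : span ℂ s ≤ (1 : Submodule ℂ (T (n+1))).comap (Dl n : T (n+1) →ₗ[ℂ] T (n+1)) := by
    rw [span_le]; exact hs
  exact this hw

lemma one_mem_one {R : Type*} [CommRing R] [Algebra ℂ R] : (1:R) ∈ (1 : Submodule ℂ R) :=
  Submodule.mem_one.2 ⟨1, by simp⟩

lemma ln_le_map {n : ℕ} (d : ℕ) (p w : V n) : ln d (io n (lin n p)) (io n (lin n w) + Xl n) ≤
    (ln (d+1) (io n (lin n p)) (io n (lin n w) + Xl n)).map (Dl n : T (n+1) →ₗ[ℂ] T (n+1)) := by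
  refine le_map_deriv (Dl n) _ (Dl_mem_one _ ?_) (q := io n (lin n w) + Xl n) (subset_span (by simp))
    (by rw [map_add, Dl_io, Dl_Xl, zero_add]) d
  rintro x (rfl | rfl)
  · rw [Dl_io]; exact zero_mem _
  · rw [map_add, Dl_io, Dl_Xl, zero_add]; exact one_mem_one

lemma pln_le_map {n : ℕ} (d : ℕ) (p p' w : V n) :
    pln d (io n (lin n p)) (io n (lin n p')) (io n (lin n w) + Xl n) ≤
    (pln (d+1) (io n (lin n p)) (io n (lin n p')) (io n (lin n w) + Xl n)).map
      (Dl n : T (n+1) →ₗ[ℂ] T (n+1)) := by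
  refine le_map_deriv (Dl n) _ (Dl_mem_one _ ?_) (q := io n (lin n w) + Xl n) (subset_span (by simp))
    (by rw [map_add, Dl_io, Dl_Xl, zero_add]) d
  rintro x (rfl | rfl | rfl)
  · rw [Dl_io]; exact zero_mem _
  · rw [Dl_io]; exact zero_mem _
  · rw [map_add, Dl_io, Dl_Xl, zero_add]; exact one_mem_one

/-- `k` lines impose independent conditions. -/
def LL (N d k : ℕ) : Prop := ∃ u v : Fin k → V N,
  k * (d+1) ≤ finrank ℂ (⨆ i, ln d (lin N (u i)) (lin N (v i)) : Submodule ℂ (T N))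

/-- `r` lines and `q` crossing pairs impose independent conditions. -/
def GG (N d r q : ℕ) : Prop := ∃ (z a b : Fin q → V N) (u v : Fin r → V N),
  r * (d+1) + q * (2*d+1) ≤ finrank ℂ ((⨆ j, (ln d (lin N (z j)) (lin N (a j)) ⊔
    ln d (lin N (z j)) (lin N (b j)))) ⊔ ⨆ i, ln d (lin N (u i)) (lin N (v i)) : Submodule ℂ (T N))

/-- A plane and `s` lines impose at least `ρ` conditions. -/
def MM (N d s ρ : ℕ) : Prop := ∃ (a b c : V N) (u v : Fin s → V N),
  ρ ≤ finrank ℂ (pln d (lin N a) (lin N b) (lin N c) ⊔ ⨆ i, ln d (lin N (u i)) (lin N (v i)) :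
    Submodule ℂ (T N))

lemma LL.split {N d a b : ℕ} (h : LL N d (a+b)) : ∃ (z w : Fin a → V N) (u v : Fin b → V N),
    (a+b) * (d+1) ≤ finrank ℂ ((⨆ j, ln d (lin N (z j)) (lin N (w j))) ⊔
      ⨆ i, ln d (lin N (u i)) (lin N (v i)) : Submodule ℂ (T N)) := by
  obtain ⟨u, v, h⟩ := h
  refine ⟨fun i => u (Fin.castAdd b i), fun i => v (Fin.castAdd b i), fun i => u (Fin.natAdd a i),
    fun i => v (Fin.natAdd a i), h.trans (finrank_mono (iSup_le fun i => ?_))⟩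
  refine Fin.addCases (fun i => ?_) (fun i => ?_) i
  · exact (le_iSup (fun i => ln d (lin N (u (Fin.castAdd b i))) (lin N (v (Fin.castAdd b i)))) i).trans le_sup_left
  · exact (le_iSup (fun i => ln d (lin N (u (Fin.natAdd a i))) (lin N (v (Fin.natAdd a i)))) i).trans le_sup_right

lemma GG.split {N d a q : ℕ} (h : GG N d (1 + a) q) : ∃ (z w b : Fin q → V N) (a₁ a₂ : V N) (u v : Fin a → V N),
    (1+a) * (d+1) + q * (2*d+1) ≤ finrank ℂ ((⨆ j, (ln d (lin N (z j)) (lin N (w j)) ⊔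
    ln d (lin N (z j)) (lin N (b j)))) ⊔ (ln d (lin N a₁) (lin N a₂) ⊔
      ⨆ i, ln d (lin N (u i)) (lin N (v i))) : Submodule ℂ (T N)) := by
  obtain ⟨z, w, b, u, v, h⟩ := h
  refine ⟨z, w, b, u (Fin.castAdd a 0), v (Fin.castAdd a 0), fun i => u (Fin.natAdd 1 i),
    fun i => v (Fin.natAdd 1 i), h.trans (finrank_mono (sup_le_sup le_rfl (iSup_le fun i => ?_)))⟩
  refine Fin.addCases (fun i => ?_) (fun i => ?_) i
  · rw [Subsingleton.elim i 0]; exact le_sup_left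
  · exact (le_iSup (fun i => ln d (lin N (u (Fin.natAdd 1 i))) (lin N (v (Fin.natAdd 1 i)))) i).trans le_sup_right

lemma iSup_ln_append {N d a b : ℕ} (u v : Fin a → V N) (u' v' : Fin b → V N) :
    (⨆ i, ln d (lin N (u i)) (lin N (v i))) ⊔ (⨆ i, ln d (lin N (u' i)) (lin N (v' i))) ≤
    ⨆ i, ln d (lin N (Fin.append u u' i)) (lin N (Fin.append v v' i)) := by
  refine sup_le (iSup_le fun i => ?_) (iSup_le fun i => ?_)
  · exact le_iSup_of_le (Fin.castAdd b i) (by simp)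
  · exact le_iSup_of_le (Fin.natAdd a i) (by simp)

lemma pow_mono' {R : Type*} [CommRing R] [Algebra ℂ R] {W W' : Submodule ℂ R} (h : W ≤ W') (d : ℕ) :
    W ^ d ≤ W' ^ d := pow_le_pow_left' h d

lemma LL.nf {n d k : ℕ} (h : LL (n+1) d k) : ∃ p w : Fin k → V n,
    k * (d+1) ≤ finrank ℂ (⨆ i, ln d (io n (lin n (p i))) (io n (lin n (w i)) + Xl n) : Submodule ℂ (T (n+1))) := by
  obtain ⟨u, v, h⟩ := h
  have z1 : Zo {ω : (Fin k → V (n+1)) × (Fin k → V (n+1)) | k * (d+1) ≤ finrank ℂ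
      (⨆ i, ln d (lin (n+1) (ω.1 i)) (lin (n+1) (ω.2 i)) : Submodule ℂ (T (n+1)))} := by
    refine PFo.zo (PFo.iSup fun i => PFo.ln d (PCo.lin _ ?_) (PCo.lin _ ?_)) _ <;> intros <;> simp
  have z2 : Zo {ω : (Fin k → V (n+1)) × (Fin k → V (n+1)) | ∀ i, ω.2 i (Fin.last n) ≠ 0} :=
    Zo.forall_ne_zero fun i => PCo.of_aff (R := ℂ) (f := fun ω : (Fin k → V (n+1)) × (Fin k → V (n+1)) =>
      ω.2 i (Fin.last n)) (by intros; simp)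
  obtain ⟨⟨u, v⟩, h1, h2⟩ := z1.inter_nonempty z2 ⟨(u, v), h⟩ ⟨(0, fun _ _ => 1), by simp⟩
  have h3 : ∀ i, ∃ p w : V n, span ℂ {lin (n+1) (u i), lin (n+1) (v i)} ≤
      span ℂ {io n (lin n p), io n (lin n w) + Xl n} := fun i => nf_line _ _ (h2 i)
  choose p w hpw using h3
  exact ⟨p, w, le_trans h1 (finrank_mono (iSup_mono fun i => pow_mono' (hpw i) d))⟩

end PL

set_option autoImplicit false
namespace PL
open Module Submodule
open scoped Polynomial Pointwise

lemma LL.nf_split {n d a b : ℕ} (h : LL (n+1) d (a+b)) : ∃ (z w : Fin a → V n) (u v : Fin b → V n),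
    (a+b) * (d+1) ≤ finrank ℂ ((⨆ j, ln d (io n (lin n (z j))) (io n (lin n (w j)) + Xl n)) ⊔
      ⨆ i, ln d (io n (lin n (u i))) (io n (lin n (v i)) + Xl n) : Submodule ℂ (T (n+1))) := by
  obtain ⟨u, v, h⟩ := h.nf
  refine ⟨fun i => u (Fin.castAdd b i), fun i => v (Fin.castAdd b i), fun i => u (Fin.natAdd a i),
    fun i => v (Fin.natAdd a i), h.trans (finrank_mono (iSup_le fun i => ?_))⟩
  refine Fin.addCases (fun i => ?_) (fun i => ?_) i
  · exact (le_iSup (fun i => ln d (io n (lin n (u (Fin.castAdd b i)))) (io n (lin n (v (Fin.castAdd b i))) + Xl n)) i).trans le_sup_left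
  · exact (le_iSup (fun i => ln d (io n (lin n (u (Fin.natAdd a i)))) (io n (lin n (v (Fin.natAdd a i))) + Xl n)) i).trans le_sup_right

lemma map_io_le_ker {n : ℕ} (A : Submodule ℂ (T n)) :
    A.map (io n).toLinearMap ≤ LinearMap.ker (Dl n : T (n+1) →ₗ[ℂ] T (n+1)) := by
  rintro _ ⟨f, _, rfl⟩
  exact Dl_io f

lemma stepG {n d q e t : ℕ} (h1 : LL (n+1) d (q+e)) (h2 : LL n (d+1) (q+t))
    (h3 : (q+t)*(d+2) + e ≤ finrank ℂ (Td n (d+1))) : GG (n+1) (d+1) (e+t) q := by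
  obtain ⟨z, b, p, w, h1⟩ := h1.nf_split
  obtain ⟨z', a', u', v', h2⟩ := h2.split
  let Ω := (Fin q → V n) × (Fin q → V n) × (Fin q → V n) × (Fin e → V n) × (Fin e → V n) ×
    (Fin t → V n) × (Fin t → V n)
  -- z, b, a, p, w, u, v
  have z1 : Zo {ω : Ω | (q+e)*(d+1) ≤ finrank ℂ ((⨆ j, ln d (io n (lin n (ω.1 j)))
      (io n (lin n (ω.2.1 j)) + Xl n)) ⊔
      ⨆ i, ln d (io n (lin n (ω.2.2.2.1 i))) (io n (lin n (ω.2.2.2.2.1 i)) + Xl n) :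
        Submodule ℂ (T (n+1)))} := by
    refine PFo.zo (PFo.sup (PFo.iSup fun i => PFo.ln d (PCo.iolin _ ?_) ((PCo.iolin _ ?_).add (PCo.const _)))
      (PFo.iSup fun i => PFo.ln d (PCo.iolin _ ?_) ((PCo.iolin _ ?_).add (PCo.const _)))) _ <;>
      intros <;> rfl
  have z2 : Zo {ω : Ω | (q+t)*(d+2) + e ≤ finrank ℂ (((⨆ j, ln (d+1) (lin n (ω.1 j)) (lin n (ω.2.2.1 j))) ⊔
      ⨆ i, ln (d+1) (lin n (ω.2.2.2.2.2.1 i)) (lin n (ω.2.2.2.2.2.2 i))) ⊔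
      ⨆ i, span ℂ {lin n (ω.2.2.2.1 i) ^ (d+1)} : Submodule ℂ (T n))} := by
    refine PFo.zo (PFo.sup (PFo.sup (PFo.iSup fun i => PFo.ln _ (PCo.lin _ ?_) (PCo.lin _ ?_))
      (PFo.iSup fun i => PFo.ln _ (PCo.lin _ ?_) (PCo.lin _ ?_)))
      (PFo.iSup fun i => PFo.singleton ((PCo.lin _ ?_).pow _))) _ <;>
      intros <;> rfl
  obtain ⟨p', hp'⟩ := fill ((⨆ j, ln (d+1) (lin n (z' j)) (lin n (a' j))) ⊔
      ⨆ i, ln (d+1) (lin n (u' i)) (lin n (v' i))) (Td n (d+1)) (fun p => lin n p ^ (d+1))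
      (by rw [Td_eq_span]; exact le_sup_right) e
  have h4 : (q+t)*(d+2) + e ≤ _ := le_trans (le_min (by simpa [add_assoc] using h2) h3) hp'
  obtain ⟨⟨z, b, a, p, w, u, v⟩, g1, g2⟩ := z1.inter_nonempty z2
    ⟨(z, b, 0, p, w, 0, 0), h1⟩ ⟨(z', 0, a', p', 0, u', v'), h4⟩
  clear h1 h2 h4 hp' z1 z2
  simp only [Set.mem_ofPred_eq] at g1 g2
  set Res : Submodule ℂ (T (n+1)) := (⨆ j, ln d (io n (lin n (z j)))
      (io n (lin n (b j)) + Xl n)) ⊔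
      ⨆ i, ln d (io n (lin n (p i))) (io n (lin n (w i)) + Xl n) with hRes
  set Tr : Submodule ℂ (T n) := ((⨆ j, ln (d+1) (lin n (z j)) (lin n (a j))) ⊔
      ⨆ i, ln (d+1) (lin n (u i)) (lin n (v i))) ⊔
      ⨆ i, span ℂ {lin n (p i) ^ (d+1)} with hTr
  let A : Submodule ℂ (T (n+1)) := (⨆ j, (ln (d+1) (io n (lin n (z j))) (io n (lin n (a j))) ⊔
    ln (d+1) (io n (lin n (z j))) (io n (lin n (b j)) + Xl n))) ⊔
    ((⨆ i, ln (d+1) (io n (lin n (p i))) (io n (lin n (w i)) + Xl n)) ⊔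
      ⨆ i, ln (d+1) (io n (lin n (u i))) (io n (lin n (v i))))
  have k1 : Res ≤ A.map (Dl n : T (n+1) →ₗ[ℂ] T (n+1)) := by
    refine sup_le (iSup_le fun j => (ln_le_map d _ _).trans (Submodule.map_mono ?_))
      (iSup_le fun j => (ln_le_map d _ _).trans (Submodule.map_mono ?_))
    · exact le_sup_of_le_left (le_iSup_of_le j le_sup_right)
    · exact le_sup_of_le_right (le_sup_of_le_left (le_iSup_of_le j le_rfl))
  have k2 : Tr.map (io n).toLinearMap ≤ A := by
    rw [hTr]
    simp only [Submodule.map_sup, Submodule.map_iSup, map_ln, Submodule.map_span, Set.image_singleton]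
    refine sup_le (sup_le (iSup_le fun j => ?_) (iSup_le fun j => ?_)) (iSup_le fun j => ?_)
    · exact le_sup_of_le_left (le_iSup_of_le j le_sup_left)
    · exact le_sup_of_le_right (le_sup_of_le_right (le_iSup_of_le j le_rfl))
    · refine le_sup_of_le_right (le_sup_of_le_left (le_iSup_of_le j ?_))
      rw [span_singleton_le_iff_mem]
      simp only [AlgHom.toLinearMap_apply, map_pow]
      exact left_mem_ln _ _ _
  have k3 := rank_step _ k1 k2 (map_io_le_ker _)
  rw [finrank_map_inj _ (io_inj n)] at k3
  refine ⟨fun j => Fin.snoc (z j) 0, fun j => Fin.snoc (a j) 0, fun j => Fin.snoc (b j) 1,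
    Fin.append (fun i => Fin.snoc (p i) 0) (fun i => Fin.snoc (u i) 0),
    Fin.append (fun i => Fin.snoc (w i) 1) (fun i => Fin.snoc (v i) 0), ?_⟩
  have k4 : (e+t)*(d+1+1) + q*(2*(d+1)+1) ≤ finrank ℂ A := by
    refine le_trans ?_ ((add_le_add g1 g2).trans k3)
    apply le_of_eq; ring
  refine k4.trans (finrank_mono ?_)
  simp only [lin_snoc_zero, lin_snoc_one]
  refine sup_le_sup le_rfl (le_trans ?_ (iSup_ln_append _ _ _ _))
  simp only [lin_snoc_zero, lin_snoc_one]
  exact le_rfl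

/-- the plane and the lines in normal form, two rank conditions -/
lemma MM.nf {n d₁ d₂ s ρ₁ ρ₂ : ℕ} (h₁ : MM (n+1) d₁ s ρ₁) (h₂ : MM (n+1) d₂ s ρ₂) :
    ∃ (a b c : V n) (p w : Fin s → V n),
    ρ₁ ≤ finrank ℂ (pln d₁ (io n (lin n a)) (io n (lin n b)) (io n (lin n c) + Xl n) ⊔
      ⨆ i, ln d₁ (io n (lin n (p i))) (io n (lin n (w i)) + Xl n) : Submodule ℂ (T (n+1))) ∧
    ρ₂ ≤ finrank ℂ (pln d₂ (io n (lin n a)) (io n (lin n b)) (io n (lin n c) + Xl n) ⊔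
      ⨆ i, ln d₂ (io n (lin n (p i))) (io n (lin n (w i)) + Xl n) : Submodule ℂ (T (n+1))) := by
  obtain ⟨a₁, b₁, c₁, u₁, v₁, h₁⟩ := h₁
  obtain ⟨a₂, b₂, c₂, u₂, v₂, h₂⟩ := h₂
  let Ω := V (n+1) × V (n+1) × V (n+1) × (Fin s → V (n+1)) × (Fin s → V (n+1))
  have z : ∀ d r, Zo {ω : Ω | r ≤ finrank ℂ (pln d (lin (n+1) ω.1) (lin (n+1) ω.2.1) (lin (n+1) ω.2.2.1) ⊔
      ⨆ i, ln d (lin (n+1) (ω.2.2.2.1 i)) (lin (n+1) (ω.2.2.2.2 i)) : Submodule ℂ (T (n+1)))} := by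
    intro d r
    refine PFo.zo (PFo.sup (PFo.pln d (PCo.lin _ ?_) (PCo.lin _ ?_) (PCo.lin _ ?_))
      (PFo.iSup fun i => PFo.ln d (PCo.lin _ ?_) (PCo.lin _ ?_))) _ <;> intros <;> rfl
  have z2 : Zo {ω : Ω | ∀ i, ω.2.2.2.2 i (Fin.last n) ≠ 0} :=
    Zo.forall_ne_zero fun i => PCo.of_aff (R := ℂ) (f := fun ω : Ω =>
      ω.2.2.2.2 i (Fin.last n)) (by intros; rfl)
  have z3 : Zo {ω : Ω | ω.2.2.1 (Fin.last n) ≠ 0} :=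
    Zo.ne_zero <| PCo.of_aff (R := ℂ) (f := fun ω : Ω =>
      ω.2.2.1 (Fin.last n)) (by intros; rfl)
  obtain ⟨⟨a, b, c, u, v⟩, ⟨h1, h2⟩, h3, h4⟩ := ((z d₁ ρ₁).inter (z d₂ ρ₂)).inter_nonempty (z2.inter z3)
    ((z d₁ ρ₁).inter_nonempty (z d₂ ρ₂) ⟨(a₁, b₁, c₁, u₁, v₁), h₁⟩ ⟨(a₂, b₂, c₂, u₂, v₂), h₂⟩)
    ⟨(0, 0, fun _ => 1, 0, fun _ _ => 1), by simp⟩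
  obtain ⟨a', b', c', hp⟩ := nf_plane a b c h4
  have h5 : ∀ i, ∃ p w : V n, span ℂ {lin (n+1) (u i), lin (n+1) (v i)} ≤
      span ℂ {io n (lin n p), io n (lin n w) + Xl n} := fun i => nf_line _ _ (h3 i)
  choose p w hpw using h5
  refine ⟨a', b', c', p, w, le_trans h1 (finrank_mono (sup_le_sup (pow_mono' hp _)
    (iSup_mono fun i => pow_mono' (hpw i) _))), le_trans h2 (finrank_mono (sup_le_sup (pow_mono' hp _)
    (iSup_mono fun i => pow_mono' (hpw i) _)))⟩

end PL

set_option autoImplicit false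
namespace PL
open Module Submodule
open scoped Polynomial Pointwise

section
variable {R : Type*} [CommRing R] [Algebra ℂ R]
/-- The difference quotient of a power. -/
noncomputable def dq (D : ℕ) (z h : R) (τ : ℂ) : R :=
  (∑ i ∈ Finset.range D, (z + τ • h) ^ i * z ^ (D - 1 - i)) * h

lemma dq_PC (D : ℕ) (z h : R) : PC (dq D z h) :=
  (PC.sum _ fun i _ => ((PC.line z h).pow i).mul (PC.const _)).mul (PC.const h)

lemma dq_smul (D : ℕ) (z h : R) (τ : ℂ) : τ • dq D z h τ = (z + τ • h) ^ D - z ^ D := by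
  rw [← geom_sum₂_mul, dq, add_sub_cancel_left, mul_smul_comm]

lemma dq_zero (D : ℕ) (z h : R) : dq D z h 0 = (D : ℂ) • (z ^ (D-1) * h) := by
  rw [dq, zero_smul, add_zero, geom_sum₂_self, Algebra.smul_def, map_natCast, mul_assoc]
end

lemma span_pair_le_Td {N : ℕ} (u v : V N) : span ℂ {lin N u, lin N v} ≤ Td N 1 := by
  rw [span_le]; rintro x (rfl | rfl) <;> exact lin_mem _

lemma ln_le_Td {N : ℕ} (d : ℕ) (u v : V N) : ln d (lin N u) (lin N v) ≤ Td N d :=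
  pow_le_Td (span_pair_le_Td u v) d

lemma pln_le_Td {N : ℕ} (d : ℕ) (u v w : V N) : pln d (lin N u) (lin N v) (lin N w) ≤ Td N d :=
  pow_le_Td (by rw [span_le]; rintro x (rfl | rfl | rfl) <;> exact lin_mem _) d

lemma io_ln_le_Td {n : ℕ} (d : ℕ) (p w : V n) :
    ln d (io n (lin n p)) (io n (lin n w) + Xl n) ≤ Td (n+1) d := by
  have h := ln_le_Td d (Fin.snoc p 0 : V (n+1)) (Fin.snoc w 1)
  rwa [lin_snoc_zero, lin_snoc_one] at h

lemma io_pln_le_Td {n : ℕ} (d : ℕ) (p p' w : V n) :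
    pln d (io n (lin n p)) (io n (lin n p')) (io n (lin n w) + Xl n) ≤ Td (n+1) d := by
  have h := pln_le_Td d (Fin.snoc p 0 : V (n+1)) (Fin.snoc p' 0) (Fin.snoc w 1)
  rwa [lin_snoc_zero, lin_snoc_zero, lin_snoc_one] at h

set_option maxHeartbeats 1000000 in
lemma stepM {n d s r q ρ : ℕ} (h1 : MM (n+1) (d+1) s ρ) (h2 : MM (n+1) d s (finrank ℂ (Td (n+1) d)))
    (hq : finrank ℂ (Td (n+1) (d+1)) ≤ ρ + q) (hG : GG n (d+2) (1+r) q) :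
    MM (n+1) (d+2) (s+r+(q+q)) (finrank ℂ (Td (n+1) (d+1)) +
      min ((1+r)*(d+3) + q*(2*d+5) + s) (finrank ℂ (Td n (d+2)))) := by
  obtain ⟨a, b, c, p, w, h1, h2⟩ := MM.nf h1 h2
  obtain ⟨z', x', y', a', b', u', v', hG⟩ := hG.split
  set A₁ : Submodule ℂ (T (n+1)) := (pln (d+1) (io n (lin n a)) (io n (lin n b)) (io n (lin n c) + Xl n) ⊔
      ⨆ i, ln (d+1) (io n (lin n (p i))) (io n (lin n (w i)) + Xl n)) with hA₁
  set A₀ : Submodule ℂ (T (n+1)) := (pln d (io n (lin n a)) (io n (lin n b)) (io n (lin n c) + Xl n) ⊔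
      ⨆ i, ln d (io n (lin n (p i))) (io n (lin n (w i)) + Xl n)) with hA₀
  have hA₀le : A₀ ≤ Td (n+1) d := by
    exact sup_le (io_pln_le_Td _ _ _ _) (iSup_le fun i => io_ln_le_Td _ _ _)
  have hA₁le : A₁ ≤ Td (n+1) (d+1) := by
    exact sup_le (io_pln_le_Td _ _ _ _) (iSup_le fun i => io_ln_le_Td _ _ _)
  have hA₀eq : A₀ = Td (n+1) d := eq_of_le_of_finrank_le hA₀le h2
  have hmap : A₀ ≤ A₁.map (Dl n : T (n+1) →ₗ[ℂ] T (n+1)) := by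
    refine sup_le ((pln_le_map d _ _ _).trans (Submodule.map_mono le_sup_left))
      (iSup_le fun i => (ln_le_map d _ _).trans (Submodule.map_mono (le_sup_of_le_right
        (le_iSup_of_le i le_rfl))))
  have hE : Td (n+1) (d+1) ≤ A₁ ⊔ span ℂ (Set.range fun z : V n => io n (lin n z) ^ (d+1)) := by
    intro F hF
    have hDF : Dl n F ∈ Td (n+1) d := by
      have := IsHomogeneous.pderiv (i := Fin.last n) hF
      exact this
    rw [← hA₀eq] at hDF
    obtain ⟨G, hG, hGF⟩ := hmap hDF
    have hk : F - G ∈ (Td n (d+1)).map (io n).toLinearMap := by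
      refine mem_map_io (sub_mem hF (hA₁le hG)) ?_
      rw [map_sub, sub_eq_zero]
      exact hGF.symm
    rw [Td_eq_span, Submodule.map_span, ← Set.range_comp] at hk
    have e : F = G + (F - G) := by ring
    rw [e]
    refine Submodule.add_mem_sup hG ?_
    have e2 : (fun z : V n => io n (lin n z) ^ (d+1)) = (io n).toLinearMap ∘ (fun p : V n => lin n p ^ (d+1)) := by
      funext z
      simp
    rw [e2]
    exact hk
  obtain ⟨z, hz⟩ := fill A₁ (Td (n+1) (d+1)) (fun z : V n => io n (lin n z) ^ (d+1)) hE q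
  have hz' : finrank ℂ (Td (n+1) (d+1)) ≤ _ := le_trans (le_min (by omega) le_rfl) hz
  obtain ⟨p', hp'⟩ := fill ((⨆ j, (ln (d+2) (lin n (z' j)) (lin n (x' j)) ⊔
    ln (d+2) (lin n (z' j)) (lin n (y' j)))) ⊔ (ln (d+2) (lin n a') (lin n b') ⊔
      ⨆ i, ln (d+2) (lin n (u' i)) (lin n (v' i)))) (Td n (d+2)) (fun p => lin n p ^ (d+2))
      (by rw [Td_eq_span]; exact le_sup_right) s
  set μ := min ((1+r)*(d+3) + q*(2*d+5) + s) (finrank ℂ (Td n (d+2))) with hμ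
  have hμ' : μ ≤ _ := le_trans (min_le_min (by
      have e : (1+r)*(d+3) + q*(2*d+5) = (1+r)*(d+2+1) + q*(2*(d+2)+1) := by ring
      rw [e]; exact Nat.add_le_add_right hG s) le_rfl) hp'
  let Ω := (V n × V n × V n × (Fin s → V n) × (Fin s → V n)) × (Fin q → V n) × (Fin q → V n) × (Fin q → V n) ×
    (Fin r → V n) × (Fin r → V n)
  have z1 : Zo {ω : Ω | finrank ℂ (Td (n+1) (d+1)) ≤ finrank ℂ ((pln (d+1) (io n (lin n ω.1.1))
      (io n (lin n ω.1.2.1)) (io n (lin n ω.1.2.2.1) + Xl n) ⊔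
      ⨆ i, ln (d+1) (io n (lin n (ω.1.2.2.2.1 i))) (io n (lin n (ω.1.2.2.2.2 i)) + Xl n)) ⊔
      ⨆ j, span ℂ {io n (lin n (ω.2.1 j)) ^ (d+1)} : Submodule ℂ (T (n+1)))} := by
    refine PFo.zo (PFo.sup (PFo.sup (PFo.pln _ (PCo.iolin _ ?_) (PCo.iolin _ ?_)
      ((PCo.iolin _ ?_).add (PCo.const _)))
      (PFo.iSup fun i => PFo.ln _ (PCo.iolin _ ?_) ((PCo.iolin _ ?_).add (PCo.const _))))
      (PFo.iSup fun i => PFo.singleton ((PCo.iolin _ ?_).pow _))) _ <;>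
      intros <;> rfl
  have z2 : Zo {ω : Ω | μ ≤ finrank ℂ (((⨆ j, (ln (d+2) (lin n (ω.2.1 j)) (lin n (ω.2.2.1 j)) ⊔
      ln (d+2) (lin n (ω.2.1 j)) (lin n (ω.2.2.2.1 j)))) ⊔ (ln (d+2) (lin n ω.1.1) (lin n ω.1.2.1) ⊔
      ⨆ i, ln (d+2) (lin n (ω.2.2.2.2.1 i)) (lin n (ω.2.2.2.2.2 i)))) ⊔
      ⨆ i, span ℂ {lin n (ω.1.2.2.2.1 i) ^ (d+2)} : Submodule ℂ (T n))} := by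
    refine PFo.zo (PFo.sup (PFo.sup (PFo.iSup fun i => PFo.sup (PFo.ln _ (PCo.lin _ ?_) (PCo.lin _ ?_))
      (PFo.ln _ (PCo.lin _ ?_) (PCo.lin _ ?_)))
      (PFo.sup (PFo.ln _ (PCo.lin _ ?_) (PCo.lin _ ?_)) (PFo.iSup fun i => PFo.ln _ (PCo.lin _ ?_) (PCo.lin _ ?_))))
      (PFo.iSup fun i => PFo.singleton ((PCo.lin _ ?_).pow _))) _ <;>
      intros <;> rfl
  obtain ⟨⟨⟨a, b, c, p, w⟩, z, x, y, u, v⟩, g1, g2⟩ := z1.inter_nonempty z2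
    ⟨((a, b, c, p, w), z, 0, 0, 0, 0), hz'⟩ ⟨((a', b', 0, p', 0), z', x', y', u', v'), hμ'⟩
  clear h1 h2 hz hz' hp' hμ' z1 z2 hG hE hmap hA₀eq hA₁le hA₀le hA₁ hA₀
  clear A₀ A₁
  simp only [Set.mem_ofPred_eq] at g1 g2
  set Res : Submodule ℂ (T (n+1)) := (pln (d+1) (io n (lin n a))
      (io n (lin n b)) (io n (lin n c) + Xl n) ⊔
      ⨆ i, ln (d+1) (io n (lin n (p i))) (io n (lin n (w i)) + Xl n)) ⊔
      ⨆ j, span ℂ {io n (lin n (z j)) ^ (d+1)} with hRes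
  set Tr : Submodule ℂ (T n) := ((⨆ j, (ln (d+2) (lin n (z j)) (lin n (x j)) ⊔
      ln (d+2) (lin n (z j)) (lin n (y j)))) ⊔ (ln (d+2) (lin n a) (lin n b) ⊔
      ⨆ i, ln (d+2) (lin n (u i)) (lin n (v i)))) ⊔
      ⨆ i, span ℂ {lin n (p i) ^ (d+2)} with hTr
  let A : ℂ → Submodule ℂ (T (n+1)) := fun τ => pln (d+2) (io n (lin n a))
      (io n (lin n b)) (io n (lin n c) + Xl n) ⊔
      (((⨆ i, ln (d+2) (io n (lin n (p i))) (io n (lin n (w i)) + Xl n)) ⊔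
        ⨆ i, ln (d+2) (io n (lin n (u i))) (io n (lin n (v i)))) ⊔
      ((⨆ j, ln (d+2) (io n (lin n (z j)) + τ • Xl n) (io n (lin n (x j)))) ⊔
        ⨆ j, ln (d+2) (io n (lin n (z j))) (io n (lin n (y j)))))
  let B : ℂ → Submodule ℂ (T (n+1)) := fun τ => A τ ⊔ ⨆ j, span ℂ {dq (d+2) (io n (lin n (z j))) (Xl n) τ}
  have hB : PF B := by
    refine PF.sup (PF.sup ((PF.triple (PC.const _) (PC.const _) (PC.const _)).pow _)
      (PF.sup (PF.sup (PF.iSup fun i => (PF.pair (PC.const _) (PC.const _)).pow _)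
        (PF.iSup fun i => (PF.pair (PC.const _) (PC.const _)).pow _))
        (PF.sup (PF.iSup fun i => (PF.pair (PC.line _ _) (PC.const _)).pow _)
        (PF.iSup fun i => (PF.pair (PC.const _) (PC.const _)).pow _))))
      (PF.iSup fun j => PF.singleton (dq_PC _ _ _))
  have hfdB : FiniteDimensional ℂ (B 0) := hB.fd 0
  have k1 : Res ≤ (B 0).map (Dl n : T (n+1) →ₗ[ℂ] T (n+1)) := by
    refine sup_le (sup_le ((pln_le_map _ _ _ _).trans (Submodule.map_mono ?_))
      (iSup_le fun j => (ln_le_map _ _ _).trans (Submodule.map_mono ?_))) (iSup_le fun j => ?_)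
    · exact le_sup_of_le_left le_sup_left
    · exact le_sup_of_le_left (le_sup_of_le_right (le_sup_of_le_left
        (le_sup_of_le_left (le_iSup_of_le j le_rfl))))
    · rw [span_singleton_le_iff_mem]
      have hd2 : ((d:ℂ)+2) ≠ 0 := by exact_mod_cast Nat.succ_ne_zero (d+1)
      refine ⟨((d:ℂ)+2)⁻¹ • dq (d+2) (io n (lin n (z j))) (Xl n) 0, Submodule.smul_mem _ _ ?_, ?_⟩
      · exact (le_sup_of_le_right (le_iSup_of_le j le_rfl) : _ ≤ B 0) (mem_span_singleton_self _)
      · rw [dq_zero, smul_smul]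
        push_cast
        rw [inv_mul_cancel₀ hd2, one_smul]
        simp only [Derivation.coeFn_coe, Derivation.leibniz, Derivation.leibniz_pow, Dl_io, Dl_Xl]
        simp
  have k2 : Tr.map (io n).toLinearMap ≤ B 0 := by
    refine le_trans ?_ (le_sup_left : A 0 ≤ B 0)
    rw [hTr]
    simp only [Submodule.map_sup, Submodule.map_iSup, map_ln, Submodule.map_span, Set.image_singleton]
    refine sup_le (sup_le (iSup_le fun j => sup_le ?_ ?_) (sup_le ?_ (iSup_le fun j => ?_))) (iSup_le fun j => ?_)
    · exact le_sup_of_le_right (le_sup_of_le_right (le_sup_of_le_left (le_iSup_of_le j (by simp))))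
    · exact le_sup_of_le_right (le_sup_of_le_right (le_sup_of_le_right (le_iSup_of_le j le_rfl)))
    · refine le_sup_of_le_left (pow_mono' (span_mono ?_) _)
      rintro x (rfl | rfl) <;> simp
    · exact le_sup_of_le_right (le_sup_of_le_left (le_sup_of_le_right (le_iSup_of_le j le_rfl)))
    · refine le_sup_of_le_right (le_sup_of_le_left (le_sup_of_le_left (le_iSup_of_le j ?_)))
      rw [span_singleton_le_iff_mem]
      simp only [AlgHom.toLinearMap_apply, map_pow]
      exact left_mem_ln _ _ _
  have k3 := rank_step _ k1 k2 (map_io_le_ker _)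
  rw [finrank_map_inj _ (io_inj n)] at k3
  have k4 : finrank ℂ (Td (n+1) (d+1)) + μ ≤ finrank ℂ (B 0) := (add_le_add g1 g2).trans k3
  obtain ⟨τ, hτ⟩ := (((hB.semicont k4).union (Set.finite_singleton (0:ℂ))).infinite_compl).nonempty
  simp only [Set.mem_compl_iff, Set.mem_union, Set.mem_ofPred_eq, Set.mem_singleton_iff, not_or, not_not] at hτ
  obtain ⟨k5, hτ⟩ := hτ
  have k6 : B τ ≤ A τ := by
    refine sup_le le_rfl (iSup_le fun j => ?_)
    rw [span_singleton_le_iff_mem]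
    have e : dq (d+2) (io n (lin n (z j))) (Xl n) τ =
      τ⁻¹ • ((io n (lin n (z j)) + τ • Xl n) ^ (d+2) - (io n (lin n (z j))) ^ (d+2)) := by
      rw [← dq_smul, smul_smul, inv_mul_cancel₀ hτ, one_smul]
    rw [e]
    refine Submodule.smul_mem _ _ (sub_mem ?_ ?_)
    · exact (le_sup_of_le_right (le_sup_of_le_right (le_sup_of_le_left (le_iSup_of_le j le_rfl))) :
        _ ≤ A τ) (left_mem_ln _ _ _)
    · exact (le_sup_of_le_right (le_sup_of_le_right (le_sup_of_le_right (le_iSup_of_le j le_rfl))) :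
        _ ≤ A τ) (left_mem_ln _ _ _)
  have hfdA : FiniteDimensional ℂ (A τ) :=
    have := hB.fd τ
    Submodule.finiteDimensional_of_le (le_sup_left : A τ ≤ B τ)
  refine ⟨Fin.snoc a 0, Fin.snoc b 0, Fin.snoc c 1,
    Fin.append (Fin.append (fun i => Fin.snoc (p i) 0) (fun i => Fin.snoc (u i) 0))
      (Fin.append (fun i => Fin.snoc (z i) τ) (fun i => Fin.snoc (z i) 0)),
    Fin.append (Fin.append (fun i => Fin.snoc (w i) 1) (fun i => Fin.snoc (v i) 0))
      (Fin.append (fun i => Fin.snoc (x i) 0) (fun i => Fin.snoc (y i) 0)), ?_⟩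
  refine (k5.trans (finrank_mono k6)).trans (finrank_mono ?_)
  simp only [lin_snoc_zero, lin_snoc_one]
  refine sup_le_sup le_rfl (le_trans (sup_le_sup (le_trans ?_ (iSup_ln_append _ _ _ _))
    (le_trans ?_ (iSup_ln_append _ _ _ _))) (iSup_ln_append _ _ _ _))
  · simp only [lin_snoc_zero, lin_snoc_one]
    exact le_rfl
  · simp only [lin_snoc, zero_smul, add_zero]
    exact le_rfl

end PL

set_option autoImplicit false
namespace PL
open Module Submodule
open scoped Polynomial Pointwise

lemma PCo.smul {R : Type*} [CommRing R] [Algebra ℂ R] {Ω : Type*} [AddCommGroup Ω] [Module ℂ Ω]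
    {c : Ω → ℂ} {f : Ω → R} (hc : PCo c) (hf : PCo f) : PCo (fun ω => c ω • f ω) :=
  fun x y => (hc x y).smul (hf x y)

/-- Points of the Segre quadric. -/
def sgV (α β : V 2) : V 4 := ![α 0 * β 0, α 0 * β 1, α 1 * β 0, α 1 * β 1]
/-- Linear forms corresponding to points of the Segre quadric. -/
noncomputable def sg (α β : V 2) : T 4 := lin 4 (sgV α β)

lemma sg_eq (α β : V 2) : sg α β = (α 0 * β 0) • (X 0 : T 4) + (α 0 * β 1) • (X 1 : T 4) +
    (α 1 * β 0) • (X 2 : T 4) + (α 1 * β 1) • (X 3 : T 4) := by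
  rw [sg, lin_apply, Fin.sum_univ_four]
  simp [sgV]

lemma sg_PCo {Ω : Type*} [AddCommGroup Ω] [Module ℂ Ω] (f g : Ω → V 2)
    (hf : ∀ x y (τ : ℂ), f (x + τ • (y - x)) = f x + τ • (f y - f x))
    (hg : ∀ x y (τ : ℂ), g (x + τ • (y - x)) = g x + τ • (g y - g x)) :
    PCo (fun ω => sg (f ω) (g ω)) := by
  have cf : ∀ i, PCo (fun ω => f ω i) := fun i => PCo.of_aff (R := ℂ) (by intros; rw [hf]; rfl)
  have cg : ∀ i, PCo (fun ω => g ω i) := fun i => PCo.of_aff (R := ℂ) (by intros; rw [hg]; rfl)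
  simp_rw [sg_eq]
  exact (((((cf 0).mul (cg 0)).smul (PCo.const _)).add (((cf 0).mul (cg 1)).smul (PCo.const _))).add
    (((cf 1).mul (cg 0)).smul (PCo.const _))).add (((cf 1).mul (cg 1)).smul (PCo.const _))

/-- The polar form of the quadric. -/
def Bq (u v : V 4) : ℂ := u 0 * v 3 + u 3 * v 0 - u 1 * v 2 - u 2 * v 1

/-- The polar form on points of the quadric -/
lemma Bq_sgV (α β γ δ : V 2) : Bq (sgV α β) (sgV γ δ) =
    (α 0 * γ 1 + (-1) * (α 1 * γ 0)) * (β 0 * δ 1 + (-1) * (β 1 * δ 0)) := by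
  simp [Bq, sgV]; ring

lemma Bq_PCo {Ω : Type*} [AddCommGroup Ω] [Module ℂ Ω] (f g h k : Ω → V 2)
    (hf : ∀ x y (τ : ℂ), f (x + τ • (y - x)) = f x + τ • (f y - f x))
    (hg : ∀ x y (τ : ℂ), g (x + τ • (y - x)) = g x + τ • (g y - g x))
    (hh : ∀ x y (τ : ℂ), h (x + τ • (y - x)) = h x + τ • (h y - h x))
    (hk : ∀ x y (τ : ℂ), k (x + τ • (y - x)) = k x + τ • (k y - k x)) :
    PCo (fun ω => Bq (sgV (f ω) (g ω)) (sgV (h ω) (k ω))) := by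
  have cf : ∀ i, PCo (fun ω => f ω i) := fun i => PCo.of_aff (R := ℂ) (by intros; rw [hf]; rfl)
  have cg : ∀ i, PCo (fun ω => g ω i) := fun i => PCo.of_aff (R := ℂ) (by intros; rw [hg]; rfl)
  have ch : ∀ i, PCo (fun ω => h ω i) := fun i => PCo.of_aff (R := ℂ) (by intros; rw [hh]; rfl)
  have ck : ∀ i, PCo (fun ω => k ω i) := fun i => PCo.of_aff (R := ℂ) (by intros; rw [hk]; rfl)
  simp_rw [Bq_sgV]
  exact (((cf 0).mul (ch 1)).add ((PCo.const _).mul ((cf 1).mul (ch 0)))).mul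
    (((cg 0).mul (ck 1)).add ((PCo.const _).mul ((cg 1).mul (ck 0))))

/-- The dual quadric operator. -/
noncomputable def Dq : T 4 →ₗ[ℂ] T 4 :=
  (pderiv 0 : Derivation ℂ (T 4) (T 4)).toLinearMap ∘ₗ (pderiv 3 : Derivation ℂ (T 4) (T 4)).toLinearMap -
  (pderiv 1 : Derivation ℂ (T 4) (T 4)).toLinearMap ∘ₗ (pderiv 2 : Derivation ℂ (T 4) (T 4)).toLinearMap

lemma Dq_apply (F : T 4) : Dq F = pderiv 0 (pderiv 3 F) - pderiv 1 (pderiv 2 F) := rfl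

lemma pderiv_lin {n : ℕ} (i : Fin n) (u : V n) : pderiv i (lin n u) = C (u i) := by
  classical
  rw [lin_apply, map_sum]
  have : ∀ j, pderiv i (u j • (X j : T n)) = if j = i then C (u i) else 0 := by
    intro j
    rw [Derivation.map_smul, pderiv_X, Pi.single_apply]
    split_ifs with h
    · subst h; rw [MvPolynomial.smul_eq_C_mul, mul_one]
    · simp
  simp_rw [this]
  simp

lemma Dq_pow_mul_pow (p p' : V 4) (hp : p 0 * p 3 = p 1 * p 2) (hp' : p' 0 * p' 3 = p' 1 * p' 2) (a b : ℕ) :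
    Dq (lin 4 p ^ (a+1) * lin 4 p' ^ (b+1)) =
      (((a:ℂ)+1) * (b+1) * Bq p p') • (lin 4 p ^ a * lin 4 p' ^ b) := by
  have h1 : (C (p 0) : T 4) * C (p 3) = C (p 1) * C (p 2) := by rw [← C_mul, hp, C_mul]
  have h2 : (C (p' 0) : T 4) * C (p' 3) = C (p' 1) * C (p' 2) := by rw [← C_mul, hp', C_mul]
  rw [Dq_apply]
  simp only [Derivation.leibniz, Derivation.leibniz_pow, pderiv_lin, map_add, map_smul, Nat.add_sub_cancel,
    smul_eq_mul, nsmul_eq_mul, Derivation.map_natCast, mul_zero, add_zero, pderiv_C, zero_add,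
    Bq, MvPolynomial.smul_eq_C_mul, map_mul, map_sub, map_one, map_natCast]
  push_cast
  generalize (lin 4 p ^ (a-1)) = x1
  generalize (lin 4 p' ^ (b-1)) = x2
  generalize (C (p 0) : T 4) = p0 at *
  generalize (C (p 1) : T 4) = p1 at *
  generalize (C (p 2) : T 4) = p2 at *
  generalize (C (p 3) : T 4) = p3 at *
  generalize (C (p' 0) : T 4) = r0 at *
  generalize (C (p' 1) : T 4) = r1 at *
  generalize (C (p' 2) : T 4) = r2 at *
  generalize (C (p' 3) : T 4) = r3 at *
  linear_combination (a+1) * a * x1 * lin 4 p' ^ (b+1) * h1 + (b+1) * b * x2 * lin 4 p ^ (a+1) * h2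

lemma Dq_pow (p : V 4) (hp : p 0 * p 3 = p 1 * p 2) (a : ℕ) : Dq (lin 4 p ^ a) = 0 := by
  have h1 : (C (p 0) : T 4) * C (p 3) = C (p 1) * C (p 2) := by rw [← C_mul, hp, C_mul]
  rw [Dq_apply]
  simp only [Derivation.leibniz, Derivation.leibniz_pow, pderiv_lin, map_add, map_smul,
    smul_eq_mul, nsmul_eq_mul, Derivation.map_natCast, mul_zero, add_zero, pderiv_C, zero_add]
  linear_combination (a * ((a-1 : ℕ) : T 4) * lin 4 p ^ (a-1-1)) * h1

lemma sgV_iso (α β : V 2) : sgV α β 0 * sgV α β 3 = sgV α β 1 * sgV α β 2 := by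
  simp [sgV]; ring

lemma Dq_sg (α β : V 2) (a : ℕ) : Dq (sg α β ^ a) = 0 := Dq_pow _ (sgV_iso α β) a

lemma sg_lin_right (α β β' : V 2) (r s : ℂ) : r • sg α β + s • sg α β' = sg α (r • β + s • β') := by
  rw [sg, sg, sg, ← map_smul, ← map_smul, ← map_add]
  congr 1
  ext i
  fin_cases i <;> simp [sgV] <;> ring

lemma ruling_le_span (α β β' : V 2) (D : ℕ) : ln D (sg α β) (sg α β') ≤
    span ℂ (Set.range fun x : V 2 × V 2 => sg x.1 x.2 ^ D) := by
  rw [ln, pow_eq_span, span_le]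
  rintro _ ⟨w, hw, rfl⟩
  obtain ⟨r, s, rfl⟩ := mem_span_pair.1 hw
  rw [sg_lin_right]
  exact subset_span ⟨(α, _), rfl⟩

lemma span_sg_le_ker (D : ℕ) : span ℂ (Set.range fun x : V 2 × V 2 => sg x.1 x.2 ^ D) ≤ LinearMap.ker Dq := by
  rw [span_le]
  rintro _ ⟨x, rfl⟩
  exact Dq_sg _ _ _

lemma ln_le_monomials {R : Type*} [CommRing R] [Algebra ℂ R] (d : ℕ) (x y : R) :
    ln d x y ≤ span ℂ {z | ∃ a b : ℕ, a + b = d ∧ z = x ^ a * y ^ b} := by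
  induction d with
  | zero =>
    rw [ln, pow_zero, Submodule.one_eq_span]
    exact span_mono (by rintro _ rfl; exact ⟨0, 0, rfl, by simp⟩)
  | succ d ih =>
    rw [ln, pow_succ]
    refine (mul_le_mul' ih le_rfl).trans ?_
    rw [span_mul_span, span_le]
    rintro _ ⟨_, ⟨a, b, rfl, rfl⟩, w, (rfl | rfl), rfl⟩
    · exact subset_span ⟨a+1, b, by omega, by simp only []; ring⟩
    · exact subset_span ⟨a, b+1, by omega, by simp only []; ring⟩

lemma monomial_mem_ln {R : Type*} [CommRing R] [Algebra ℂ R] (a b : ℕ) (x y : R) :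
    x ^ a * y ^ b ∈ ln (a+b) x y := by
  rw [ln, pow_add]
  exact Submodule.mul_mem_mul (Submodule.pow_mem_pow _ (subset_span (by simp)) _)
    (Submodule.pow_mem_pow _ (subset_span (by simp)) _)

lemma ln_le_map_Dq (d : ℕ) (α β γ δ : V 2) (h : Bq (sgV α β) (sgV γ δ) ≠ 0) :
    ln d (sg α β) (sg γ δ) ≤ (ln (d+2) (sg α β) (sg γ δ)).map Dq := by
  refine (ln_le_monomials _ _ _).trans ?_
  rw [span_le]
  rintro _ ⟨a, b, rfl, rfl⟩
  have hc : ((a:ℂ)+1) * (b+1) * Bq (sgV α β) (sgV γ δ) ≠ 0 :=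
    mul_ne_zero (mul_ne_zero (Nat.cast_add_one_ne_zero a) (Nat.cast_add_one_ne_zero b)) h
  refine ⟨(((a:ℂ)+1) * (b+1) * Bq (sgV α β) (sgV γ δ))⁻¹ • (sg α β ^ (a+1) * sg γ δ ^ (b+1)),
    Submodule.smul_mem _ _ ?_, ?_⟩
  · have := monomial_mem_ln (a+1) (b+1) (sg α β) (sg γ δ)
    rwa [show a + 1 + (b + 1) = a + b + 2 by omega] at this
  · rw [map_smul, sg, sg, Dq_pow_mul_pow _ _ (sgV_iso _ _) (sgV_iso _ _), smul_smul, inv_mul_cancel₀ hc, one_smul]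

/-- isotropic vectors -/
lemma exists_sgV (p : V 4) (hp : p 0 * p 3 = p 1 * p 2) : ∃ α β, p = sgV α β := by
  by_cases h0 : p 0 = 0
  · rw [h0, zero_mul] at hp
    by_cases h1 : p 1 = 0
    · refine ⟨![0, 1], ![p 2, p 3], ?_⟩
      ext i; fin_cases i <;> simp [sgV, h0, h1]
    · have h2 : p 2 = 0 := by
        rcases mul_eq_zero.1 hp.symm with h | h
        · exact absurd h h1
        · exact h
      refine ⟨![1, p 3 / p 1], ![0, p 1], ?_⟩
      ext i; fin_cases i <;> simp [sgV, h0, h2]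
      field_simp
  · refine ⟨![1, p 2 / p 0], ![p 0, p 1], ?_⟩
    ext i; fin_cases i <;> simp [sgV]
    · field_simp
    · field_simp
      linear_combination hp

/-- secant lines -/
lemma secant (u v : V 4) (hv : v 0 * v 3 + (-1) * (v 1 * v 2) ≠ 0)
    (hd : Bq u v ^ 2 + (-4) * ((u 0 * u 3 + (-1) * (u 1 * u 2)) * (v 0 * v 3 + (-1) * (v 1 * v 2))) ≠ 0) :
    ∃ α β γ δ, Bq (sgV α β) (sgV γ δ) ≠ 0 ∧
      span ℂ {lin 4 u, lin 4 v} ≤ span ℂ {sg α β, sg γ δ} := by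
  set Qv := v 0 * v 3 + (-1) * (v 1 * v 2) with hQv
  set Qu := u 0 * u 3 + (-1) * (u 1 * u 2) with hQu
  obtain ⟨r, hr⟩ := IsAlgClosed.exists_pow_nat_eq (Bq u v ^ 2 + (-4) * (Qu * Qv)) (n := 2) (by norm_num)
  have hr0 : r ≠ 0 := by rintro rfl; apply hd; rw [← hr]; simp
  have hQ : ∀ l : ℂ, (u + l • v) 0 * (u + l • v) 3 - (u + l • v) 1 * (u + l • v) 2 =
      Qu + l * Bq u v + l ^ 2 * Qv := by
    intro l; simp [Qu, Qv, Bq]; ring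
  have hroot : ∀ r : ℂ, r ^ 2 = Bq u v ^ 2 + (-4) * (Qu * Qv) →
      Qu + ((-Bq u v + r)/(2*Qv)) * Bq u v + ((-Bq u v + r)/(2*Qv)) ^ 2 * Qv = 0 := by
    intro r hr
    field_simp
    linear_combination hr
  set l1 := (-Bq u v + r)/(2*Qv) with hl1
  set l2 := (-Bq u v + (-r))/(2*Qv) with hl2
  have e1 := hroot r hr
  have e2 := hroot (-r) (by rw [neg_sq]; exact hr)
  rw [← hQ, sub_eq_zero] at e1 e2
  obtain ⟨α, β, h1⟩ := exists_sgV _ e1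
  obtain ⟨γ, δ, h2⟩ := exists_sgV _ e2
  have hl : l1 - l2 ≠ 0 := by
    have : l1 - l2 = r / Qv := by rw [hl1, hl2]; field_simp; ring
    rw [this]; exact div_ne_zero hr0 hv
  refine ⟨α, β, γ, δ, ?_, ?_⟩
  · rw [← h1, ← h2]
    have : Bq (u + l1 • v) (u + l2 • v) = 2 * Qu + (l1 + l2) * Bq u v + 2 * l1 * l2 * Qv := by
      simp [Qu, Qv, Bq]; ring
    rw [this]
    have : 2 * Qu + (l1 + l2) * Bq u v + 2 * l1 * l2 * Qv = - r ^ 2 / Qv := by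
      rw [hl1, hl2]
      field_simp
      linear_combination hr
    rw [this]
    exact div_ne_zero (neg_ne_zero.2 (pow_ne_zero _ hr0)) hv
  · rw [sg, sg, ← h1, ← h2, span_le]
    have hv' : lin 4 v ∈ span ℂ {lin 4 (u + l1 • v), lin 4 (u + l2 • v)} := by
      refine mem_span_pair.2 ⟨(l1 - l2)⁻¹, -(l1-l2)⁻¹, ?_⟩
      rw [← map_smul, ← map_smul, ← map_add]
      congr 1
      ext i
      simp
      field_simp
      ring
    rintro x (rfl | rfl)
    · have : lin 4 u = lin 4 (u + l1 • v) - l1 • lin 4 v := by simp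
      rw [this]
      exact sub_mem (subset_span (Set.mem_insert _ _)) (Submodule.smul_mem _ _ hv')
    · exact hv'

end PL

set_option autoImplicit false
namespace PL
open Module Submodule
open scoped Polynomial Pointwise

/-- Parametrization of the quadric. -/
noncomputable def phiQ : T 4 →ₐ[ℂ] ℂ[X][X] :=
  aeval ![Polynomial.X, 1, Polynomial.C Polynomial.X * Polynomial.X, Polynomial.C Polynomial.X]

lemma phiQ_e0 (c : ℂ) : phiQ (sg ![1, c] ![1, 0]) =
    Polynomial.C (1 + Polynomial.C c * Polynomial.X) * Polynomial.X := by
  rw [sg_eq]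
  simp [phiQ, Polynomial.smul_eq_C_mul, Algebra.smul_def]
  ring

lemma phiQ_e1 (c : ℂ) : phiQ (sg ![1, c] ![0, 1]) =
    Polynomial.C (1 + Polynomial.C c * Polynomial.X) := by
  rw [sg_eq]
  simp [phiQ, Polynomial.smul_eq_C_mul, Algebra.smul_def]

lemma coeff_lp (c : ℂ) (d k : ℕ) :
    ((1 + Polynomial.C c * Polynomial.X : ℂ[X]) ^ d).coeff k = d.choose k * c ^ k := by
  have : (1 + Polynomial.C c * Polynomial.X : ℂ[X]) ^ d =
      ((1 + Polynomial.X : ℂ[X]) ^ d).comp (Polynomial.C c * Polynomial.X) := by simp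
  rw [this, Polynomial.comp_C_mul_X_coeff, Polynomial.coeff_one_add_X_pow]

lemma rulings_indep (d t : ℕ) (ht : t ≤ d + 1) :
    t * (d+1) ≤ finrank ℂ (⨆ i : Fin t, ln d (sg ![1, (i : ℕ)] ![1, 0]) (sg ![1, (i : ℕ)] ![0, 1]) :
      Submodule ℂ (T 4)) := by
  classical
  let w : Fin t × Fin (d+1) → T 4 := fun x =>
    sg ![1, (x.1 : ℕ)] ![1, 0] ^ (x.2 : ℕ) * sg ![1, (x.1 : ℕ)] ![0, 1] ^ (d - (x.2 : ℕ))
  have hw : LinearIndependent ℂ w := by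
    apply LinearIndependent.of_comp phiQ.toLinearMap
    have e : (phiQ.toLinearMap ∘ w) = fun x =>
        Polynomial.C ((1 + Polynomial.C ((x.1 : ℕ) : ℂ) * Polynomial.X) ^ d) * Polynomial.X ^ (x.2 : ℕ) := by
      ext1 x
      simp only [Function.comp, w, AlgHom.toLinearMap_apply, map_mul, map_pow, phiQ_e0, phiQ_e1]
      rw [mul_pow, mul_right_comm, ← pow_add]
      congr 3
      omega
    rw [e, Fintype.linearIndependent_iff]
    intro g hg
    have h1 : ∀ j : Fin (d+1), ∀ k : ℕ, k ≤ d → ∑ i : Fin t, g (i, j) * ((i : ℕ) : ℂ) ^ k = 0 := by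
      intro j k hk
      have := congrArg (fun p : ℂ[X][X] => (p.coeff (j:ℕ)).coeff k) hg
      simp only [Polynomial.finsetSum_coeff, Polynomial.coeff_smul, Polynomial.coeff_C_mul_X_pow,
        Polynomial.coeff_zero, Fintype.sum_prod_type] at this
      have h2 : ∀ (i : Fin t) (j' : Fin (d+1)), (g (i, j') • if (j : ℕ) = (j' : ℕ) then
          (1 + Polynomial.C ((i : ℕ) : ℂ) * Polynomial.X) ^ d else 0 : ℂ[X]).coeff k =
          if j' = j then ((d.choose k : ℂ)) * (g (i, j) * ((i : ℕ) : ℂ) ^ k) else 0 := by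
        intro i j'
        by_cases h : j' = j
        · subst h; rw [if_pos rfl, if_pos rfl, Polynomial.coeff_smul, coeff_lp, smul_eq_mul]; ring
        · simp [h, Fin.val_inj, Ne.symm h]
      simp only [← Polynomial.coeff_smul] at this
      simp only [h2, Finset.sum_ite_eq', Finset.mem_univ, if_true] at this
      rw [← Finset.mul_sum] at this
      refine (mul_eq_zero.1 this).resolve_left ?_
      exact_mod_cast (Nat.choose_pos hk).ne'
    rintro ⟨i, j⟩
    have := Matrix.eq_zero_of_forall_pow_sum_mul_pow_eq_zero (f := fun i : Fin t => ((i : ℕ) : ℂ))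
      (v := fun i => g (i, j)) (by intro a b hab; exact Fin.ext (by simpa using hab))
      (fun k => h1 j k (by omega))
    exact congrFun this i
  have h1 := finrank_span_eq_card hw
  rw [Fintype.card_prod, Fintype.card_fin, Fintype.card_fin] at h1
  rw [← h1]
  refine finrank_mono ?_
  rw [span_le]
  rintro _ ⟨⟨i, j⟩, rfl⟩
  refine (le_iSup (fun i : Fin t => ln d (sg ![1, (i : ℕ)] ![1, 0]) (sg ![1, (i : ℕ)] ![0, 1])) i) ?_
  have := monomial_mem_ln (j:ℕ) (d - (j:ℕ)) (sg ![1, (i : ℕ)] ![1, 0]) (sg ![1, (i : ℕ)] ![0, 1])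
  rwa [show (j:ℕ) + (d - j) = d by omega] at this

lemma LL.secant {d k : ℕ} (h : LL 4 d k) : ∃ α β γ δ : Fin k → V 2,
    (∀ i, Bq (sgV (α i) (β i)) (sgV (γ i) (δ i)) ≠ 0) ∧
    k * (d+1) ≤ finrank ℂ (⨆ i, ln d (sg (α i) (β i)) (sg (γ i) (δ i)) : Submodule ℂ (T 4)) := by
  obtain ⟨u, v, h⟩ := h
  let Ω := (Fin k → V 4) × (Fin k → V 4)
  have z1 : Zo {ω : Ω | k * (d+1) ≤ finrank ℂ
      (⨆ i, ln d (lin 4 (ω.1 i)) (lin 4 (ω.2 i)) : Submodule ℂ (T 4))} := by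
    refine PFo.zo (PFo.iSup fun i => PFo.ln d (PCo.lin _ ?_) (PCo.lin _ ?_)) _ <;> intros <;> rfl
  have cu : ∀ i j, PCo (fun ω : Ω => ω.1 i j) := fun i j => PCo.of_aff (R := ℂ) (by intros; rfl)
  have cv : ∀ i j, PCo (fun ω : Ω => ω.2 i j) := fun i j => PCo.of_aff (R := ℂ) (by intros; rfl)
  have cQu : ∀ i, PCo (fun ω : Ω => ω.1 i 0 * ω.1 i 3 + (-1) * (ω.1 i 1 * ω.1 i 2)) := fun i =>
    ((cu i 0).mul (cu i 3)).add ((PCo.const _).mul ((cu i 1).mul (cu i 2)))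
  have cQv : ∀ i, PCo (fun ω : Ω => ω.2 i 0 * ω.2 i 3 + (-1) * (ω.2 i 1 * ω.2 i 2)) := fun i =>
    ((cv i 0).mul (cv i 3)).add ((PCo.const _).mul ((cv i 1).mul (cv i 2)))
  have cB : ∀ i, PCo (fun ω : Ω => Bq (ω.1 i) (ω.2 i)) := fun i => by
    have : (fun ω : Ω => Bq (ω.1 i) (ω.2 i)) = fun ω : Ω => ω.1 i 0 * ω.2 i 3 + ω.1 i 3 * ω.2 i 0 +
      (-1) * (ω.1 i 1 * ω.2 i 2 + ω.1 i 2 * ω.2 i 1) := by ext; simp only [Bq]; ring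
    rw [this]
    exact (((cu i 0).mul (cv i 3)).add ((cu i 3).mul (cv i 0))).add ((PCo.const _).mul
      (((cu i 1).mul (cv i 2)).add ((cu i 2).mul (cv i 1))))
  have z2 : Zo {ω : Ω | ∀ i, ω.2 i 0 * ω.2 i 3 + (-1) * (ω.2 i 1 * ω.2 i 2) ≠ 0} :=
    Zo.forall_ne_zero cQv
  have z3 : Zo {ω : Ω | ∀ i, Bq (ω.1 i) (ω.2 i) ^ 2 + (-4) *
    ((ω.1 i 0 * ω.1 i 3 + (-1) * (ω.1 i 1 * ω.1 i 2)) * (ω.2 i 0 * ω.2 i 3 + (-1) * (ω.2 i 1 * ω.2 i 2))) ≠ 0} :=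
    Zo.forall_ne_zero fun i => ((cB i).pow 2).add ((PCo.const _).mul ((cQu i).mul (cQv i)))
  obtain ⟨⟨u, v⟩, h1, h2, h3⟩ := z1.inter_nonempty (z2.inter z3) ⟨(u, v), h⟩
    ⟨(fun _ => ![1,0,0,-1], fun _ => ![1,0,0,1]), by simp, by simp [Bq]⟩
  have h4 := fun i => PL.secant (u i) (v i) (h2 i) (h3 i)
  choose α β γ δ hB hs using h4
  exact ⟨α, β, γ, δ, hB, le_trans h1 (finrank_mono (iSup_mono fun i => pow_mono' (hs i) d))⟩

end PL

set_option autoImplicit false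
namespace PL
open Module Submodule
open scoped Polynomial Pointwise

lemma iSup_fin_add {R : Type*} [CommRing R] [Algebra ℂ R] {a b : ℕ} (A : Fin (a+b) → Submodule ℂ R) :
    (⨆ i, A i) = (⨆ i, A (Fin.castAdd b i)) ⊔ ⨆ i, A (Fin.natAdd a i) := by
  apply le_antisymm
  · refine iSup_le fun i => ?_
    refine Fin.addCases (fun i => ?_) (fun i => ?_) i
    · exact le_sup_of_le_left (le_iSup (fun i => A (Fin.castAdd b i)) i)
    · exact le_sup_of_le_right (le_iSup (fun i => A (Fin.natAdd a i)) i)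
  · exact sup_le (iSup_le fun i => le_iSup A _) (iSup_le fun i => le_iSup A _)

set_option maxHeartbeats 1000000 in
lemma stepQ {d q e t : ℕ} (h1 : LL 4 d (q+e)) (ht : q + t ≤ d + 3)
    (h3 : (q+t)*(d+3) + (q + (e + e)) ≤ (d+3) * (d+3)) : GG 4 (d+2) (e+t) q := by
  obtain ⟨α₀, β₀, γ₀, δ₀, hB, h1⟩ := h1.secant
  let Ω := ((Fin q → V 2) × (Fin q → V 2) × (Fin q → V 2) × (Fin q → V 2) × (Fin q → V 2)) ×
    ((Fin e → V 2) × (Fin e → V 2) × (Fin e → V 2) × (Fin e → V 2)) ×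
    ((Fin t → V 2) × (Fin t → V 2) × (Fin t → V 2))
  have z1 : Zo {ω : Ω | (q+e)*(d+1) ≤ finrank ℂ ((⨆ j, ln d (sg (ω.1.1 j) (ω.1.2.1 j))
      (sg (ω.1.2.2.2.1 j) (ω.1.2.2.2.2 j))) ⊔
      ⨆ i, ln d (sg (ω.2.1.1 i) (ω.2.1.2.1 i)) (sg (ω.2.1.2.2.1 i) (ω.2.1.2.2.2 i)) :
        Submodule ℂ (T 4))} := by
    refine PFo.zo (PFo.sup (PFo.iSup fun i => PFo.ln d (sg_PCo _ _ ?_ ?_) (sg_PCo _ _ ?_ ?_))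
      (PFo.iSup fun i => PFo.ln d (sg_PCo _ _ ?_ ?_) (sg_PCo _ _ ?_ ?_))) _ <;>
      intros <;> rfl
  have z1q : Zo {ω : Ω | ∀ j, Bq (sgV (ω.1.1 j) (ω.1.2.1 j)) (sgV (ω.1.2.2.2.1 j) (ω.1.2.2.2.2 j)) ≠ 0} := by
    refine Zo.forall_ne_zero (f := fun j (ω : Ω) =>
      Bq (sgV (ω.1.1 j) (ω.1.2.1 j)) (sgV (ω.1.2.2.2.1 j) (ω.1.2.2.2.2 j))) fun j =>
      Bq_PCo (fun ω : Ω => ω.1.1 j) (fun ω => ω.1.2.1 j) (fun ω => ω.1.2.2.2.1 j)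
        (fun ω => ω.1.2.2.2.2 j) ?_ ?_ ?_ ?_ <;> intros <;> rfl
  have z1e : Zo {ω : Ω | ∀ j, Bq (sgV (ω.2.1.1 j) (ω.2.1.2.1 j)) (sgV (ω.2.1.2.2.1 j) (ω.2.1.2.2.2 j)) ≠ 0} := by
    refine Zo.forall_ne_zero (f := fun j (ω : Ω) =>
      Bq (sgV (ω.2.1.1 j) (ω.2.1.2.1 j)) (sgV (ω.2.1.2.2.1 j) (ω.2.1.2.2.2 j))) fun j =>
      Bq_PCo (fun ω : Ω => ω.2.1.1 j) (fun ω => ω.2.1.2.1 j) (fun ω => ω.2.1.2.2.1 j)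
        (fun ω => ω.2.1.2.2.2 j) ?_ ?_ ?_ ?_ <;> intros <;> rfl
  have z2 : Zo {ω : Ω | (q+t)*(d+3) + (q + (e+e)) ≤ finrank ℂ (((⨆ j, ln (d+2) (sg (ω.1.1 j) (ω.1.2.1 j))
      (sg (ω.1.1 j) (ω.1.2.2.1 j))) ⊔
      ⨆ i, ln (d+2) (sg (ω.2.2.1 i) (ω.2.2.2.1 i)) (sg (ω.2.2.1 i) (ω.2.2.2.2 i))) ⊔
      ((⨆ j, span ℂ {sg (ω.1.2.2.2.1 j) (ω.1.2.2.2.2 j) ^ (d+2)}) ⊔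
      ((⨆ i, span ℂ {sg (ω.2.1.1 i) (ω.2.1.2.1 i) ^ (d+2)}) ⊔
       ⨆ i, span ℂ {sg (ω.2.1.2.2.1 i) (ω.2.1.2.2.2 i) ^ (d+2)})) : Submodule ℂ (T 4))} := by
    refine PFo.zo (PFo.sup (PFo.sup (PFo.iSup fun i => PFo.ln _ (sg_PCo _ _ ?_ ?_) (sg_PCo _ _ ?_ ?_))
      (PFo.iSup fun i => PFo.ln _ (sg_PCo _ _ ?_ ?_) (sg_PCo _ _ ?_ ?_)))
      (PFo.sup (PFo.iSup fun i => PFo.singleton ((sg_PCo _ _ ?_ ?_).pow _))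
        (PFo.sup (PFo.iSup fun i => PFo.singleton ((sg_PCo _ _ ?_ ?_).pow _))
          (PFo.iSup fun i => PFo.singleton ((sg_PCo _ _ ?_ ?_).pow _))))) _ <;>
      intros <;> rfl
  -- witness for the trace
  have hA := rulings_indep (d+2) (q+t) ht
  have hE := rulings_indep (d+2) (d+3) le_rfl
  obtain ⟨y, hy⟩ := fill (⨆ i : Fin (q+t), ln (d+2) (sg ![1, (i : ℕ)] ![1, 0]) (sg ![1, (i : ℕ)] ![0, 1]))
    (⨆ i : Fin (d+3), ln (d+2) (sg ![1, (i : ℕ)] ![1, 0]) (sg ![1, (i : ℕ)] ![0, 1]))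
    (fun x : V 2 × V 2 => sg x.1 x.2 ^ (d+2))
    (le_sup_of_le_right (iSup_le fun i => ruling_le_span _ _ _ _)) (q + (e+e))
  have h4 : (q+t)*(d+3) + (q + (e+e)) ≤ _ := le_trans (le_min (add_le_add hA le_rfl) (h3.trans hE)) hy
  rw [iSup_fin_add, iSup_fin_add, iSup_fin_add] at h4
  rw [iSup_fin_add] at h1
  obtain ⟨⟨⟨α, β, β', γ, δ⟩, ⟨a, b, c, f⟩, ⟨α', b₁, b₂⟩⟩, ⟨⟨g1, g1q⟩, g1e⟩, g2⟩ :=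
    ((z1.inter z1q).inter z1e).inter_nonempty z2
    ⟨((fun j => α₀ (Fin.castAdd e j), fun j => β₀ (Fin.castAdd e j), 0, fun j => γ₀ (Fin.castAdd e j),
        fun j => δ₀ (Fin.castAdd e j)),
      (fun j => α₀ (Fin.natAdd q j), fun j => β₀ (Fin.natAdd q j), fun j => γ₀ (Fin.natAdd q j),
        fun j => δ₀ (Fin.natAdd q j)), (0, 0, 0)), ⟨h1, fun j => hB _⟩, fun j => hB _⟩
    ⟨((fun j => ![1, ((Fin.castAdd t j : ℕ) : ℂ)], fun j => ![1,0], fun j => ![0, 1],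
        fun j => (y (Fin.castAdd (e+e) j)).1, fun j => (y (Fin.castAdd (e+e) j)).2),
      (fun j => (y (Fin.natAdd q (Fin.castAdd e j))).1, fun j => (y (Fin.natAdd q (Fin.castAdd e j))).2,
        fun j => (y (Fin.natAdd q (Fin.natAdd e j))).1, fun j => (y (Fin.natAdd q (Fin.natAdd e j))).2),
      (fun j => ![1, ((Fin.natAdd q j : ℕ) : ℂ)], fun j => ![1, 0], fun j => ![0,1])), h4⟩
  clear h1 h4 hy z1 z1q z1e z2 hA hE
  simp only [Set.mem_ofPred_eq] at g1 g2 g1q g1e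
  let A : Submodule ℂ (T 4) := (⨆ j, (ln (d+2) (sg (α j) (β j)) (sg (α j) (β' j)) ⊔
    ln (d+2) (sg (α j) (β j)) (sg (γ j) (δ j)))) ⊔
    ((⨆ i, ln (d+2) (sg (a i) (b i)) (sg (c i) (f i))) ⊔
      ⨆ i, ln (d+2) (sg (α' i) (b₁ i)) (sg (α' i) (b₂ i)))
  have k1 : ((⨆ j, ln d (sg (α j) (β j)) (sg (γ j) (δ j))) ⊔
      ⨆ i, ln d (sg (a i) (b i)) (sg (c i) (f i))) ≤ A.map Dq := by
    refine sup_le (iSup_le fun j => (ln_le_map_Dq d _ _ _ _ (g1q j)).trans (Submodule.map_mono ?_))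
      (iSup_le fun j => (ln_le_map_Dq d _ _ _ _ (g1e j)).trans (Submodule.map_mono ?_))
    · exact le_sup_of_le_left (le_iSup_of_le j le_sup_right)
    · exact le_sup_of_le_right (le_sup_of_le_left (le_iSup_of_le j le_rfl))
  have k2 : (((⨆ j, ln (d+2) (sg (α j) (β j)) (sg (α j) (β' j))) ⊔
      ⨆ i, ln (d+2) (sg (α' i) (b₁ i)) (sg (α' i) (b₂ i))) ⊔
      ((⨆ j, span ℂ {sg (γ j) (δ j) ^ (d+2)}) ⊔
      ((⨆ i, span ℂ {sg (a i) (b i) ^ (d+2)}) ⊔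
       ⨆ i, span ℂ {sg (c i) (f i) ^ (d+2)}))) ≤ A := by
    refine sup_le (sup_le (iSup_le fun j => ?_) (iSup_le fun j => ?_))
      (sup_le (iSup_le fun j => ?_) (sup_le (iSup_le fun j => ?_) (iSup_le fun j => ?_)))
    · exact le_sup_of_le_left (le_iSup_of_le j le_sup_left)
    · exact le_sup_of_le_right (le_sup_of_le_right (le_iSup_of_le j le_rfl))
    · refine le_sup_of_le_left (le_iSup_of_le j (le_sup_of_le_right ?_))
      rw [span_singleton_le_iff_mem]
      exact right_mem_ln _ _ _
    · refine le_sup_of_le_right (le_sup_of_le_left (le_iSup_of_le j ?_))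
      rw [span_singleton_le_iff_mem]
      exact left_mem_ln _ _ _
    · refine le_sup_of_le_right (le_sup_of_le_left (le_iSup_of_le j ?_))
      rw [span_singleton_le_iff_mem]
      exact right_mem_ln _ _ _
  have k2' : (((⨆ j, ln (d+2) (sg (α j) (β j)) (sg (α j) (β' j))) ⊔
      ⨆ i, ln (d+2) (sg (α' i) (b₁ i)) (sg (α' i) (b₂ i))) ⊔
      ((⨆ j, span ℂ {sg (γ j) (δ j) ^ (d+2)}) ⊔
      ((⨆ i, span ℂ {sg (a i) (b i) ^ (d+2)}) ⊔
       ⨆ i, span ℂ {sg (c i) (f i) ^ (d+2)}))) ≤ LinearMap.ker Dq := by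
    refine sup_le (sup_le (iSup_le fun j => ?_) (iSup_le fun j => ?_))
      (sup_le (iSup_le fun j => ?_) (sup_le (iSup_le fun j => ?_) (iSup_le fun j => ?_)))
    · exact (ruling_le_span _ _ _ _).trans (span_sg_le_ker _)
    · exact (ruling_le_span _ _ _ _).trans (span_sg_le_ker _)
    all_goals
      rw [span_singleton_le_iff_mem]
      exact Dq_sg _ _ _
  have k3 := rank_step _ k1 k2 k2'
  refine ⟨fun j => sgV (α j) (β j), fun j => sgV (α j) (β' j), fun j => sgV (γ j) (δ j),
    Fin.append (fun i => sgV (a i) (b i)) (fun i => sgV (α' i) (b₁ i)),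
    Fin.append (fun i => sgV (c i) (f i)) (fun i => sgV (α' i) (b₂ i)), ?_⟩
  have k4 : (e+t)*(d+2+1) + q*(2*(d+2)+1) ≤ finrank ℂ A := by
    refine le_trans ?_ ((add_le_add g1 g2).trans k3)
    apply le_of_eq; ring
  refine k4.trans (finrank_mono ?_)
  exact sup_le_sup le_rfl (iSup_ln_append _ _ _ _)

lemma GG.toLL {N d r : ℕ} (h : GG N d r 0) : LL N d r := by
  obtain ⟨z, a, b, u, v, h⟩ := h
  refine ⟨u, v, ?_⟩
  rw [iSup_of_empty, bot_sup_eq, zero_mul, add_zero] at h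
  exact h

lemma finrank_ln_le {R : Type*} [CommRing R] [Algebra ℂ R] (d : ℕ) (x y : R) :
    finrank ℂ (ln d x y) ≤ d + 1 := by
  have h : ln d x y ≤ span ℂ (Set.range fun i : Fin (d+1) => x ^ (i:ℕ) * y ^ (d - (i:ℕ))) := by
    refine (ln_le_monomials d x y).trans (span_mono ?_)
    rintro _ ⟨a, b, rfl, rfl⟩
    refine ⟨⟨a, by omega⟩, ?_⟩
    simp
  have := FiniteDimensional.span_of_finite ℂ (Set.finite_range fun i : Fin (d+1) => x ^ (i:ℕ) * y ^ (d - (i:ℕ)))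
  refine (finrank_mono h).trans ((finrank_range_le_card _).trans ?_)
  simp

lemma finrank_iSup_ln_le {R : Type*} [CommRing R] [Algebra ℂ R] (d k : ℕ) (x y : Fin k → R) :
    finrank ℂ (⨆ i, ln d (x i) (y i) : Submodule ℂ R) ≤ k * (d + 1) := by
  induction k with
  | zero => rw [iSup_of_empty]; simp
  | succ k ih =>
    rw [iSup_fin_add]
    refine (finrank_add_le_finrank_add_finrank _ _).trans ?_
    have h1 := ih (fun i => x (Fin.castAdd 1 i)) (fun i => y (Fin.castAdd 1 i))
    have h2 : finrank ℂ (⨆ i : Fin 1, ln d (x (Fin.natAdd k i)) (y (Fin.natAdd k i)) : Submodule ℂ R) ≤ d + 1 := by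
      rw [iSup_unique]
      exact finrank_ln_le _ _ _
    calc _ ≤ k * (d+1) + (d+1) := add_le_add h1 h2
      _ = _ := by ring

lemma LL.mono {N d k k' : ℕ} (h : LL N d k) (hk : k' ≤ k) : LL N d k' := by
  obtain ⟨r, rfl⟩ := Nat.exists_eq_add_of_le hk
  obtain ⟨u, v, u', v', h⟩ := h.split
  refine ⟨u, v, ?_⟩
  have h1 := h.trans (finrank_add_le_finrank_add_finrank _ _)
  have h2 := finrank_iSup_ln_le d r (fun i => lin N (u' i)) (fun i => lin N (v' i))
  rw [add_mul] at h1
  omega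

lemma MM.mono {N d s ρ s' ρ' : ℕ} (h : MM N d s ρ) (hs : s ≤ s') (hρ : ρ' ≤ ρ) : MM N d s' ρ' := by
  obtain ⟨r, rfl⟩ := Nat.exists_eq_add_of_le hs
  obtain ⟨a, b, c, u, v, h⟩ := h
  refine ⟨a, b, c, Fin.append u (0 : Fin r → V N), Fin.append v (0 : Fin r → V N),
    hρ.trans (h.trans (finrank_mono (sup_le_sup le_rfl ?_)))⟩
  exact le_trans le_sup_left (iSup_ln_append u v 0 0)

lemma fill0 (n k : ℕ) : ∃ y : Fin k → V (n+1), min k (n+1) ≤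
    finrank ℂ (⨆ i, span ℂ {lin (n+1) (y i)} : Submodule ℂ (T (n+1))) := by
  obtain ⟨y, hy⟩ := fill ⊥ (Td (n+1) 1) (fun p => lin (n+1) p)
      (by rw [Td_eq_span]; simp only [pow_one]; exact le_sup_right) k
  refine ⟨y, ?_⟩
  rw [finrank_Td, finrank_bot, bot_sup_eq, add_comm 1 n, Nat.choose_succ_self_right, zero_add] at hy
  exact hy

lemma LL.fill1 (n k : ℕ) (h : k + k ≤ n + 1) : LL (n+1) 1 k := by
  obtain ⟨y, hy⟩ := fill0 n (k+k)
  rw [iSup_fin_add] at hy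
  refine ⟨fun i => y (Fin.castAdd k i), fun i => y (Fin.natAdd k i), ?_⟩
  refine le_trans (by omega) (hy.trans (finrank_mono (sup_le (iSup_mono fun i => ?_) (iSup_mono fun i => ?_))))
  all_goals
    rw [ln, pow_one]
    exact span_mono (by simp)

/-- all the powers of linear forms -/
lemma MM.fill1 (n s ρ : ℕ) (h : ρ ≤ n + 1) (h' : ρ ≤ s + s + 3) : MM (n+1) 1 s ρ := by
  obtain ⟨y, hy⟩ := fill0 n (s+s+3)
  rw [iSup_fin_add, iSup_fin_add] at hy
  refine ⟨y (Fin.natAdd (s+s) 0), y (Fin.natAdd (s+s) 1), y (Fin.natAdd (s+s) 2),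
    fun i => y (Fin.castAdd 3 (Fin.castAdd s i)), fun i => y (Fin.castAdd 3 (Fin.natAdd s i)), ?_⟩
  rw [sup_comm] at hy
  refine le_trans (by omega) (hy.trans (finrank_mono (sup_le_sup (iSup_le fun i => ?_)
    (sup_le (iSup_mono fun i => ?_) (iSup_mono fun i => ?_)))))
  · rw [pln, pow_one]
    apply span_mono
    fin_cases i <;> simp
  all_goals
    rw [ln, pow_one]
    exact span_mono (by simp)

lemma MM.deg0 (n s : ℕ) : MM (n+1) 0 s 1 := by
  refine ⟨0, 0, 0, 0, 0, ?_⟩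
  rw [Nat.one_le_iff_ne_zero, ← Nat.pos_iff_ne_zero]
  refine lt_of_lt_of_le ?_ (finrank_mono (le_sup_left))
  rw [pln, pow_zero, Submodule.one_eq_span, finrank_span_singleton one_ne_zero]
  exact one_pos

lemma LL.deg0 (n : ℕ) : LL (n+1) 0 1 := by
  refine ⟨0, 0, ?_⟩
  rw [iSup_unique, ln, pow_zero, Submodule.one_eq_span, finrank_span_singleton one_ne_zero]

/-- number of lines in P^3 -/
def be (d : ℕ) : ℕ := if d % 2 = 0 then (d/2+1)*(d/2+2)/2 else (d/2+2)*(d/2+3)/2-1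

lemma LL4 (j : ℕ) : LL 4 (2*j) ((j+1)*(j+2)/2) ∧ LL 4 (2*j+1) ((j+2)*(j+3)/2-1) := by
  induction j with
  | zero => exact ⟨LL.deg0 3, LL.fill1 3 2 (by norm_num)⟩
  | succ j ih =>
    obtain ⟨i1, i2⟩ := ih
    have e1 : (j+1+1)*(j+1+2)/2 = (j+1)*(j+2)/2 + (j+2) := by
      rw [← Nat.add_mul_div_right _ _ (by norm_num : 0 < 2)]; congr 1; ring
    have e2 : (j+1+2)*(j+1+3)/2 = (j+2)*(j+3)/2 + (j+3) := by
      rw [← Nat.add_mul_div_right _ _ (by norm_num : 0 < 2)]; congr 1; ring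
    have e3 : (j+2)*(j+3)/2 = (j+1)*(j+2)/2 + (j+2) := e1
    have e4 := Nat.div_mul_le_self ((j+1)*(j+2)) 2
    refine ⟨?_, ?_⟩
    · rw [e1]
      refine GG.toLL (stepQ (d := 2*j) (by simpa using i1) (by omega) ?_)
      nlinarith
    · rw [e2]
      have := GG.toLL (stepQ (d := 2*j+1) (e := (j+2)*(j+3)/2-1) (q := 0) (t := j+3) (by simpa using i2) (by omega) (by
        rw [e3]
        generalize (j+1)*(j+2)/2 = B at *
        have : B + (j+2) - 1 = B + j + 1 := by omega
        rw [this]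
        nlinarith))
      rwa [show (j+2)*(j+3)/2 - 1 + (j+3) = (j+2)*(j+3)/2 + (j+3) - 1 by omega] at this

lemma LL4' (d : ℕ) : LL 4 d (be d) := by
  rcases Nat.even_or_odd' d with ⟨j, rfl | rfl⟩
  · have : be (2*j) = (j+1)*(j+2)/2 := by
      simp [be]
    rw [this]; exact (LL4 j).1
  · have : be (2*j+1) = (j+2)*(j+3)/2-1 := by
      have h1 : (2*j+1) % 2 ≠ 0 := by omega
      have h2 : (2*j+1)/2 = j := by omega
      rw [be, if_neg h1, h2]
    rw [this]; exact (LL4 j).2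

lemma finrank_pln_le {R : Type*} [CommRing R] [Algebra ℂ R] (d : ℕ) (x y z : R) :
    finrank ℂ (pln d x y z) ≤ (d+2).choose 2 := by
  have h : pln d x y z ≤ (Td 3 d).map (aeval ![x, y, z] : T 3 →ₐ[ℂ] R).toLinearMap := by
    intro f hf
    have e : Set.range ![x, y, z] = {x, y, z} := by
      ext w; simp [Matrix.range_cons, Matrix.range_empty]; tauto
    rw [pln, ← e] at hf
    obtain ⟨F, hF, rfl⟩ := mem_span_range_pow _ _ hf
    exact ⟨F, hF, rfl⟩
  refine (finrank_mono h).trans ((finrank_map_le _ _).trans ?_)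
  rw [finrank_Td]

lemma sup_pow_le {R : Type*} [CommRing R] [Algebra ℂ R] (L C : Submodule ℂ R) (d : ℕ) :
    (L ⊔ C) ^ (d+1) ≤ L ^ (d+1) ⊔ C * (L ⊔ C) ^ d := by
  induction d with
  | zero => simp
  | succ d ih =>
    rw [pow_succ (L ⊔ C) (d+1)]
    refine (mul_le_mul' ih le_rfl).trans ?_
    rw [Submodule.sup_mul, Submodule.mul_sup, mul_assoc C, ← pow_succ, ← pow_succ]
    refine sup_le (sup_le_sup le_rfl ?_) le_sup_right
    rw [mul_comm]
    exact mul_le_mul' le_rfl (pow_mono' le_sup_left _)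

lemma finrank_pln_le_ln {R : Type*} [CommRing R] [Algebra ℂ R] (d : ℕ) (x y z : R) :
    ∃ B : Submodule ℂ R, FiniteDimensional ℂ B ∧ pln (d+1) x y z ≤ ln (d+1) x y ⊔ B ∧ finrank ℂ B ≤ (d+2).choose 2 := by
  refine ⟨(pln d x y z).map (LinearMap.mulLeft ℂ z), inferInstance, ?_, (finrank_map_le _ _).trans (finrank_pln_le d x y z)⟩
  have e : span ℂ {x, y, z} = span ℂ {x, y} ⊔ span ℂ {z} := by
    rw [← span_union]; congr 1; ext w; simp; tauto
  rw [pln, pln, e]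
  refine (sup_pow_le _ _ _).trans (sup_le_sup le_rfl ?_)
  rw [Submodule.mul_le]
  intro m hm n hn
  obtain ⟨r, rfl⟩ := mem_span_singleton.1 hm
  exact ⟨r • n, Submodule.smul_mem _ _ hn, by simp⟩

/-- From a plane to a line. -/
lemma MM.toLL {N d f : ℕ} (h : MM N (d+1) f ((d+3).choose 2 + f * (d+2))) : LL N (d+1) (f+1) := by
  obtain ⟨a, b, c, u, v, h⟩ := h
  refine ⟨Fin.append u (fun _ : Fin 1 => a), Fin.append v fun _ : Fin 1 => b, ?_⟩
  obtain ⟨B, _, hB, hB'⟩ := finrank_pln_le_ln d (lin N a) (lin N b) (lin N c)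
  have h1 := (h.trans (finrank_mono (sup_le_sup hB le_rfl)))
  rw [sup_right_comm] at h1
  have h2 := h1.trans (finrank_add_le_finrank_add_finrank _ _)
  have h3 : (d+3).choose 2 = (d+2).choose 2 + (d+2) := by
    rw [Nat.choose_succ_succ' (d+2) 1, Nat.choose_one_right, add_comm]
  have h4 : (f+1) * (d+2) = f * (d+2) + (d+2) := by ring
  refine le_trans (b := finrank ℂ (ln (d + 1) ((lin N) a) ((lin N) b) ⊔
    ⨆ i, ln (d + 1) ((lin N) (u i)) ((lin N) (v i)) : Submodule ℂ (T N))) ?_ (finrank_mono ?_)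
  · show (f+1) * (d+2) ≤ _
    omega
  · refine le_trans ?_ (iSup_ln_append _ _ _ _)
    rw [sup_comm, iSup_unique (f := fun _ : Fin 1 => _)]

end PL

set_option autoImplicit false
namespace PL
open Module Submodule
open scoped Polynomial Pointwise

lemma coreG {m D q r Le Lt : ℕ} (h1 : LL (m+1+1) (D+1) Le) (h2 : LL (m+1) (D+2) Lt) (K0 : q ≤ Le) (K0' : q ≤ Lt)
    (Ka : q * (D+3) + (1 + r) ≤ (D+2+m).choose m)
    (K2 : 1 + r + 2 * q ≤ Le + Lt)
    (K : (1 + r + 2 * q) * (D+3) ≤ (D+2+m).choose m + q + (D+2) * Le) :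
    GG (m+1+1) (D+2) (1+r) q := by
  by_cases h : 1 + r + q ≤ Le
  · have := stepG (n := m+1) (d := D+1) (q := q) (e := 1+r) (t := 0) (h1.mono (by omega)) (h2.mono (by omega))
      (by rw [finrank_Td]; exact Ka)
    simpa using this
  · push Not at h
    obtain ⟨e, rfl⟩ := Nat.exists_eq_add_of_le K0
    obtain ⟨t, ht⟩ := Nat.exists_eq_add_of_le h.le
    have := stepG (n := m+1) (d := D+1) (q := q) (e := e) (t := t) h1 (h2.mono (by omega))
      (by
        rw [finrank_Td]
        show (q+t) * (D+3) + e ≤ (D+2+m).choose m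
        have e1 : 1 + r + 2 * q = (q + t) + (q + e) := by omega
        rw [e1] at K
        nlinarith)
    rwa [show e + t = 1 + r by omega] at this

/-- The main statement. -/
def Main (n d : ℕ) : Prop := ∀ s, (d+n).choose n ≤ (d+2).choose 2 + s*(d+1) + d →
  (d+2).choose 2 + s*(d+1) ≤ (d+n).choose n + d →
  MM (n+1) d s (min ((d+2).choose 2 + s*(d+1)) ((d+n).choose n))

lemma choose_mono_n {n m d : ℕ} (h : n ≤ m) : (d+n).choose n ≤ (d+m).choose m := by
  rw [← Nat.choose_symm_add, ← Nat.choose_symm_add]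
  exact Nat.choose_le_choose _ (by omega)

lemma Main.indep {n d : ℕ} (hn : 2 ≤ n) (h : Main n d) : ∃ s q, q < d + 1 ∧
    (d+n).choose n = (d+2).choose 2 + s*(d+1) + q ∧ MM (n+1) d s ((d+2).choose 2 + s*(d+1)) := by
  have h0 : (d+2).choose 2 ≤ (d+n).choose n := choose_mono_n hn
  obtain ⟨M, hM⟩ := Nat.exists_eq_add_of_le h0
  have h1 := Nat.div_add_mod M (d+1)
  have h2 := Nat.mod_lt M (show 0 < d+1 by omega)
  rw [mul_comm] at h1
  refine ⟨M/(d+1), M % (d+1), h2, by omega, ?_⟩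
  have := h (M/(d+1)) (by omega) (by omega)
  rwa [min_eq_left (by omega)] at this

lemma Main.span {n d s : ℕ} (hn : 2 ≤ n) (h : Main n d) (hs : (d+n).choose n ≤ (d+2).choose 2 + s*(d+1)) :
    MM (n+1) d s ((d+n).choose n) := by
  obtain ⟨s', q, hq, e, h1⟩ := h.indep hn
  by_cases hq0 : q = 0
  · subst hq0
    have : s' * (d+1) ≤ s * (d+1) := by omega
    exact h1.mono (Nat.le_of_mul_le_mul_right this (by omega)) (by omega)
  · have h2 := h (s'+1) (by rw [add_mul]; omega) (by rw [add_mul]; omega)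
    rw [min_eq_right (by rw [add_mul]; omega)] at h2
    refine h2.mono ?_ le_rfl
    by_contra hc
    have : s * (d+1) ≤ s' * (d+1) := Nat.mul_le_mul_right _ (by omega)
    omega

lemma Main.LL {n d : ℕ} (hn : 2 ≤ n) (h : Main n (d+1)) : ∃ L, PL.LL (n+1) (d+1) L ∧
    (d+1+n).choose n + 1 ≤ (d+3).choose 2 + L*(d+2) := by
  obtain ⟨s, q, hq, e, h1⟩ := h.indep hn
  refine ⟨s+1, h1.toLL, ?_⟩
  rw [add_mul]
  rw [show d + 1 + 2 = d + 3 from rfl, show d + 1 + 1 = d + 2 from rfl] at e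
  omega

lemma two_choose (d : ℕ) : 2 * (d+2).choose 2 = (d+2) * (d+1) := by
  rw [Nat.choose_two_right, Nat.mul_div_cancel']
  · rfl
  · exact (Nat.even_mul_pred_self _).two_dvd

lemma Main.zero (n : ℕ) : Main n 0 := by
  intro s _ _
  exact (MM.deg0 n s).mono le_rfl (by simp)

lemma Main.one (n : ℕ) : Main n 1 := by
  intro s _ _
  have e : (1+n).choose n = n + 1 := by rw [add_comm, Nat.choose_succ_self_right]
  have e2 : (1+2).choose 2 = 3 := rfl
  exact MM.fill1 n s _ (by omega) (by omega)

/-- The inductive step. -/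
lemma Main.step {n D : ℕ} (hn : 2 ≤ n) (h0 : Main n D) (h1 : Main n (D+1))
    (hN : ∀ s' q, q < D+2 → (D+1+n).choose n = (D+3).choose 2 + s'*(D+2) + q →
      ((D+n).choose n ≤ (D+2).choose 2 + s'*(D+1)) ∧
      ∀ s, (D+2+n).choose n ≤ (D+4).choose 2 + s*(D+3) + (D+2) →
        (D+4).choose 2 + s*(D+3) ≤ (D+2+n).choose n + (D+2) →
        ∃ r, s = s' + r + (q+q) ∧ GG n (D+2) (1+r) q) : Main n (D+2) := by
  intro s hs1 hs2
  obtain ⟨s', q, hq, e, i1⟩ := h1.indep hn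
  obtain ⟨n, rfl⟩ : ∃ m, n = m + 1 := ⟨n-1, by omega⟩
  obtain ⟨N2, hN⟩ := hN s' q hq e
  obtain ⟨r, rfl, hG⟩ := hN s hs1 hs2
  have i0 := h0.span hn N2
  have hp : (D+2+(n+1)).choose (n+1) = (D+1+(n+1)).choose (n+1) + (D+2+n).choose n := by
    have := Nat.choose_succ_succ' (D+2+n) n
    rw [show D+2+n+1 = D+2+(n+1) by omega] at this
    rw [this, show D+1+(n+1) = D+2+n by omega, add_comm]
  have := stepM (n := n+1) (d := D) (s := s') (r := r) (q := q) i1 (by rw [finrank_Td]; exact i0)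
    (by rw [finrank_Td]; omega) hG
  refine this.mono le_rfl ?_
  rw [finrank_Td, finrank_Td, hp, ← Nat.add_min_add_left]
  refine min_le_min ?_ le_rfl
  have e3 : (D+4).choose 2 = (D+3).choose 2 + (D+3) := by
    rw [Nat.choose_succ_succ' (D+3) 1, Nat.choose_one_right, add_comm]
  show (D+4).choose 2 + _ ≤ _
  rw [e, e3]
  apply le_of_eq
  ring

/-- Conversion -/
lemma Main.final {n d s : ℕ} (hn : 2 ≤ n) (hM : Main n d)
    (h : (d+n).choose n ≤ (d+2).choose 2 + s * (d+1)) :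
    ∃ (a b c : MvPolynomial (Fin (n+1)) ℂ) (l m : Fin s → MvPolynomial (Fin (n+1)) ℂ),
      a.IsHomogeneous 1 ∧ b.IsHomogeneous 1 ∧ c.IsHomogeneous 1 ∧ (∀ i, (l i).IsHomogeneous 1) ∧
      (∀ i, (m i).IsHomogeneous 1) ∧ ∀ f : MvPolynomial (Fin (n+1)) ℂ, f.IsHomogeneous d →
      ∃ (F : Fin s → MvPolynomial (Fin 2) ℂ) (G : MvPolynomial (Fin 3) ℂ),
        (∀ i, (F i).IsHomogeneous d) ∧ G.IsHomogeneous d ∧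
        f = (∑ i, aeval ![l i, m i] (F i)) + aeval ![a, b, c] G := by
  obtain ⟨a, b, c, u, v, hr⟩ := hM.span hn h
  refine ⟨lin _ a, lin _ b, lin _ c, fun i => lin _ (u i), fun i => lin _ (v i), lin_hom _, lin_hom _, lin_hom _,
    fun i => lin_hom _, fun i => lin_hom _, ?_⟩
  have hle : (pln d (lin (n+1) a) (lin (n+1) b) (lin (n+1) c) ⊔ ⨆ i, ln d (lin (n+1) (u i)) (lin (n+1) (v i)) :
      Submodule ℂ (T (n+1))) ≤ Td (n+1) d := by
    refine sup_le (pow_le_Td (span_le.2 ?_) d) (iSup_le fun i => pow_le_Td (span_le.2 ?_) d)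
    · rintro x (rfl | rfl | rfl) <;> exact lin_mem _
    · rintro x (rfl | rfl) <;> exact lin_mem _
  have heq := Submodule.eq_of_le_of_finrank_le hle (by rw [finrank_Td]; exact hr)
  intro f hf
  have hf' : f ∈ Td (n+1) d := hf
  rw [← heq] at hf'
  obtain ⟨g, hg, k, hk, rfl⟩ := Submodule.mem_sup.1 hf'
  obtain ⟨μ, hμ⟩ := (Submodule.mem_iSup_iff_exists_finsupp _ _).1 hk
  have e3 : Set.range ![lin (n+1) a, lin (n+1) b, lin (n+1) c] = {lin (n+1) a, lin (n+1) b, lin (n+1) c} := by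
    ext w; simp [Matrix.range_cons, Matrix.range_empty]; tauto
  have e2 : ∀ i, Set.range ![lin (n+1) (u i), lin (n+1) (v i)] = {lin (n+1) (u i), lin (n+1) (v i)} := by
    intro i; ext w; simp [Matrix.range_cons, Matrix.range_empty]; tauto
  rw [pln, ← e3] at hg
  obtain ⟨G, hG, hG'⟩ := mem_span_range_pow _ _ hg
  have hF : ∀ i, ∃ F : T 2, F.IsHomogeneous d ∧ μ i = aeval ![lin (n+1) (u i), lin (n+1) (v i)] F := by
    intro i
    have := hμ.1 i
    rw [ln, ← e2] at this
    exact mem_span_range_pow _ _ this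
  choose F hF hF' using hF
  refine ⟨F, G, hF, hG, ?_⟩
  rw [← hG', ← hμ.2, Finsupp.sum_fintype _ _ (by simp), add_comm g]
  congr 1
  exact Finset.sum_congr rfl fun i _ => hF' i

end PL

set_option autoImplicit false
namespace PL
open Module Submodule
open scoped Polynomial Pointwise

lemma rel_all (m D : ℕ) :
    (D+2+(m+2)).choose (m+2) = (D+1+(m+2)).choose (m+2) + (D+2+(m+1)).choose (m+1) ∧
    (D+2+(m+1)).choose (m+1) = (D+2+m).choose m + (D+1+(m+1)).choose (m+1) ∧
    (D+1+(m+2)).choose (m+2) = (D+(m+2)).choose (m+2) + (D+1+(m+1)).choose (m+1) ∧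
    (m+2) * (D+1+(m+2)).choose (m+2) = (D+2) * (D+2+(m+1)).choose (m+1) ∧
    (m+1) * (D+1+(m+1)).choose (m+1) = (D+2) * (D+2+m).choose m := by
  refine ⟨?_, ?_, ?_, ?_, ?_⟩
  · rw [show D+2+(m+2) = (D+m+3)+1 by ring, Nat.choose_succ_succ, add_comm]
    congr 2 <;> ring
  · rw [show D+2+(m+1) = (D+m+2)+1 by ring, Nat.choose_succ_succ]
    congr 2 <;> ring
  · rw [show D+1+(m+2) = (D+m+2)+1 by ring, Nat.choose_succ_succ, add_comm]
    congr 2 <;> ring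
  · have := Nat.choose_succ_right_eq (D+m+3) (m+1)
    rw [show D+m+3-(m+1) = D+2 by omega] at this
    rw [show D+1+(m+2) = D+m+3 by ring, show D+2+(m+1) = D+m+3 by ring]
    linarith
  · have := Nat.choose_succ_right_eq (D+m+2) m
    rw [show D+m+2-m = D+2 by omega] at this
    rw [show D+1+(m+1) = D+m+2 by ring, show D+2+m = D+m+2 by ring]
    linarith

lemma numN2 {m D s' q : ℕ} (hm : 2 ≤ m) (hq : q < D + 2)
    (e : (D+1+(m+2)).choose (m+2) = (D+3).choose 2 + s'*(D+2) + q) :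
    (D+(m+2)).choose (m+2) ≤ (D+2).choose 2 + s'*(D+1) := by
  obtain ⟨-, r2, r3, r4, r5⟩ := rel_all m D
  have hC : (m+2).choose 2 ≤ (D+2+m).choose m := by
    rw [← Nat.choose_symm_add, show m + 2 = 2 + m by ring]
    exact Nat.choose_le_choose _ (by omega)
  have hC' := two_choose m
  have t1 := two_choose D
  have t2 := two_choose (D+1)
  rw [show D+1+2 = D+3 by ring] at t2
  generalize (D+2+(m+1)).choose (m+1) = H at *
  generalize (D+1+(m+1)).choose (m+1) = E at *
  generalize (D+2+m).choose m = C at *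
  generalize (D+1+(m+2)).choose (m+2) = G at *
  generalize (D+(m+2)).choose (m+2) = G0 at *
  generalize (D+3).choose 2 = A at *
  generalize (D+2).choose 2 = B at *
  generalize (m+2).choose 2 = F at *
  subst r2
  zify at *
  have hC3 : 3 * ((m:ℤ)+2) ≤ 2 * C := by nlinarith
  -- multiply by 2 (D+2) (m+2)
  have key : ((m:ℤ)+2) * (2 * q + (D+2)) ≤ 2 * (D+2) * C := by nlinarith
  have e2 : 2 * ((m:ℤ)+2) * (((D:ℤ)+2) * E) = 2 * (m+2) * G + 2 * (D+1) * ((D+2)*C) := by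
    linear_combination (2 * (D+2):ℤ) * r5 - 2 * r4
  have e3 : ((m:ℤ)+2) * (2 * G + (D+1)*(2*q+(D+2))) ≤ (m+2) * (2 * ((D+2) * E)) := by
    nlinarith [mul_le_mul_of_nonneg_left key (show (0:ℤ) ≤ D+1 by positivity)]
  have e4 := le_of_mul_le_mul_left e3 (by positivity)
  have e5 : 2 * ((D:ℤ)+2) * G0 ≤ 2 * (D+2) * (B + s' * (D+1)) := by
    have : 2 * ((D:ℤ)+2) * (B + s' * (D+1)) - 2 * (D+2) * G0 = 2 * ((D+2)*E) - (2 * G + (D+1)*(2*q+(D+2))) := by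
      linear_combination ((D:ℤ)+2) * t1 + (2 * (D+2):ℤ) * r3 - (2*(D+1):ℤ) * e - (D+1:ℤ) * t2
    linarith
  exact le_of_mul_le_mul_left e5 (by positivity)

lemma be_even (j : ℕ) : 2 * be (2*j) = (j+1)*(j+2) := by
  unfold be
  rw [if_pos (by omega), show 2*j/2 = j by omega, Nat.mul_div_cancel']
  exact (Nat.even_mul_succ_self (j+1)).two_dvd

lemma be_odd (j : ℕ) : 2 * be (2*j+1) + 2 = (j+2)*(j+3) := by
  unfold be
  rw [if_neg (by omega), show (2*j+1)/2 = j by omega]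
  have h : 2 * ((j+2)*(j+3)/2) = (j+2)*(j+3) := Nat.mul_div_cancel' (Nat.even_mul_succ_self (j+2)).two_dvd
  have : 0 < (j+2)*(j+3) := by positivity
  omega

lemma choose4 (d : ℕ) : 24 * (d+4).choose 4 = (d+4)*(d+3)*(d+2)*(d+1) := by
  have := Nat.descFactorial_eq_factorial_mul_choose (d+4) 4
  simp [Nat.descFactorial, Nat.factorial] at this
  linarith

lemma six_dvd (j : ℕ) : ∃ Z, 6 * Z = (j+1)*(j+2)*(2*j+3) := by
  induction j with
  | zero => exact ⟨1, rfl⟩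
  | succ j ih =>
    obtain ⟨Z, hZ⟩ := ih
    exact ⟨Z + (j+2)^2, by linear_combination hZ⟩

lemma three_dvd (j : ℕ) : ∃ Z, 3 * Z = (2*j+5)*(j+2)*(2*j+3) := by
  induction j with
  | zero => exact ⟨10, rfl⟩
  | succ j ih =>
    obtain ⟨Z, hZ⟩ := ih
    exact ⟨Z + (2*j+5)*(2*j+5), by linear_combination hZ⟩

lemma step4_odd {j s' q s : ℕ} (hq : q < 2*j+1+2)
    (e : (2*j+1+1+4).choose 4 = (2*j+1+3).choose 2 + s'*(2*j+1+2) + q)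
    (h1 : (2*j+1+2+4).choose 4 ≤ (2*j+1+4).choose 2 + s*(2*j+1+3) + (2*j+1+2))
    (h2 : (2*j+1+4).choose 2 + s*(2*j+1+3) ≤ (2*j+1+2+4).choose 4 + (2*j+1+2)) :
    ∃ r, s = s' + r + (q+q) ∧ GG 4 (2*j+1+2) (1+r) q := by
  have c1 := choose4 (2*j+1+1)
  have c2 := choose4 (2*j+1+2)
  have t1 := two_choose (2*j+2)
  have t2 := two_choose (2*j+3)
  have hb := be_odd j
  have hL := LL4' (2*j+1)
  obtain ⟨X, hX⟩ := six_dvd (j+1)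
  rw [show 2*j+2+2 = 2*j+1+3 by ring] at t1
  rw [show 2*j+3+2 = 2*j+1+4 by ring] at t2
  generalize (2*j+1+1+4).choose 4 = G at *
  generalize (2*j+1+2+4).choose 4 = N at *
  generalize (2*j+1+3).choose 2 = A at *
  generalize (2*j+1+4).choose 2 = B at *
  generalize be (2*j+1) = b at *
  have g1 : G = (2*j+3) * X := by nlinarith
  have a1 : A = (2*j+3) * (j+2) := by nlinarith
  have q0 : q = 0 := by
    have : (2*j+3) * (s' + (j+2)) + q = (2*j+3) * X := by rw [← g1, e, a1]; ring
    have h3 : (2*j+3) ∣ q := (Nat.dvd_add_right (Dvd.intro _ rfl)).1 (this ▸ Dvd.intro _ rfl)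
    exact Nat.eq_zero_of_dvd_of_lt h3 (by omega)
  subst q0
  have s1 : s' + (j+2) = X := by
    have : (2*j+3) * (s' + (j+2)) = (2*j+3) * X := by rw [← g1, e, a1]; ring
    exact Nat.eq_of_mul_eq_mul_left (by omega) this
  -- bounds on s
  have u1 : 4 * s + 2 < 4 * s' + (2*j+5)*(j+3) + 4 := by
    by_contra hc
    push Not at hc
    nlinarith
  have u2 : 4 * s' + (2*j+5)*(j+3) < 4 * s + 2 + 4 := by
    by_contra hc
    push Not at hc
    nlinarith
  have hs : s' ≤ s := by nlinarith
  obtain ⟨r, rfl⟩ := Nat.exists_eq_add_of_le hs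
  refine ⟨r, by ring, ?_⟩
  by_cases hr : 1 + r ≤ b
  · have := stepQ (d := 2*j+1) (q := 0) (e := 1+r) (t := 0) (hL.mono (by omega)) (by omega) (by nlinarith)
    simpa using this
  · obtain ⟨t, ht⟩ := Nat.exists_eq_add_of_le (not_le.1 hr).le
    have h4 : 4 * t ≤ j + 12 := by nlinarith
    have := stepQ (d := 2*j+1) (q := 0) (e := b) (t := t) (hL.mono (by omega)) (by omega) (by
      have h5 := Nat.mul_le_mul_right (2*j+4) h4
      clear * - h5 hb
      nlinarith)
    rw [ht]; exact this

set_option maxHeartbeats 1000000 in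
lemma step4_even {j s' q s : ℕ} (hq : q < 2*j+2)
    (e : (2*j+1+4).choose 4 = (2*j+3).choose 2 + s'*(2*j+2) + q)
    (h1 : (2*j+2+4).choose 4 ≤ (2*j+4).choose 2 + s*(2*j+3) + (2*j+2))
    (h2 : (2*j+4).choose 2 + s*(2*j+3) ≤ (2*j+2+4).choose 4 + (2*j+2)) :
    ∃ r, s = s' + r + (q+q) ∧ GG 4 (2*j+2) (1+r) q := by
  have c1 := choose4 (2*j+1)
  have c2 := choose4 (2*j+2)
  have t1 := two_choose (2*j+1)
  have t2 := two_choose (2*j+2)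
  have hb := be_even j
  have hL := LL4' (2*j)
  obtain ⟨Y, hY⟩ := three_dvd j
  obtain ⟨Z, hZ⟩ := six_dvd (j+1)
  rw [show 2*j+1+2 = 2*j+3 by ring] at t1
  rw [show 2*j+2+2 = 2*j+4 by ring] at t2
  generalize (2*j+1+4).choose 4 = G at *
  generalize (2*j+2+4).choose 4 = N at *
  generalize (2*j+3).choose 2 = A at *
  generalize (2*j+4).choose 2 = B at *
  generalize be (2*j) = b at *
  have g1 : 4 * G = (2*j+2) * Y := by
    have := congrArg (fun z => (2*j+2) * z) hY
    linarith
  have n1 : N = (2*j+3) * Z := by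
    have := congrArg (fun z => (2*j+3) * z) hZ
    linarith
  have a2 : 2 * A = (2*j+2) * (2*j+3) := by rw [t1]; ring
  have hc : ∃ c, 4 * q = (2*j+2) * c := by
    have : (2*j+2) * (4*s' + 2*(2*j+3)) + 4 * q = (2*j+2) * Y := by rw [← g1, e]; linarith
    have h3 : (2*j+2) ∣ 4*q := (Nat.dvd_add_right (Dvd.intro _ rfl)).1 (this ▸ Dvd.intro _ rfl)
    exact h3
  obtain ⟨c, hc⟩ := hc
  have c4 : c < 4 := by
    by_contra h; push Not at h
    have := Nat.mul_le_mul_left (2*j+2) h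
    omega
  have s1 : 4*s' + 2*(2*j+3) + c = Y := by
    have : (2*j+2) * (4*s' + 2*(2*j+3) + c) = (2*j+2) * Y := by rw [← g1, e]; linarith
    exact Nat.eq_of_mul_eq_mul_left (by omega) this
  have b1 : B = (2*j+3) * (j+2) := by linarith
  have s2 : s + (j+2) = Z := by
    rw [n1, b1] at h1 h2
    clear * - h1 h2
    apply le_antisymm
    · by_contra h; push Not at h
      have := Nat.mul_le_mul_left (2*j+3) h
      rw [Nat.succ_eq_add_one] at this
      linarith
    · by_contra h; push Not at h
      have := Nat.mul_le_mul_left (2*j+3) h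
      rw [Nat.succ_eq_add_one] at this
      linarith
  have u : 4 * s = 4 * s' + (2*j*j+9*j+8+c) := by linarith
  have hjc : c ≤ j + 2 := by
    by_contra h
    push Not at h
    obtain rfl : j = 0 := by omega
    omega
  have hs : s' + 2 * q ≤ s := by
    suffices 8 * q ≤ 2*j*j+9*j+8+c by omega
    rcases Nat.lt_or_ge j 2 with hj | hj
    · interval_cases j <;> omega
    · have : c ≤ 3 := by omega
      clear * - hc this hj
      nlinarith
  obtain ⟨r, rfl⟩ := Nat.exists_eq_add_of_le hs
  refine ⟨r, by ring, ?_⟩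
  have hr : 4 * r + 8 * q = 2*j*j+9*j+8+c := by omega
  have hq3 : 4 * q ≤ 6 * j + 6 := by
    have : c ≤ 3 := by omega
    clear * - hc this
    nlinarith
  have hqb : q ≤ b := by
    clear * - hc hjc hb
    nlinarith
  by_cases hr' : 1 + r + q ≤ b
  · have := stepQ (d := 2*j) (q := q) (e := 1+r) (t := 0) (hL.mono (by omega)) (by omega) (by
      clear * - hr hq3 c4
      nlinarith)
    simpa using this
  · obtain ⟨f, rfl⟩ := Nat.exists_eq_add_of_le hqb
    obtain ⟨t, ht⟩ := Nat.exists_eq_add_of_le (not_le.1 hr').le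
    have h4 : 4 * (q + t) = 3*j+8+c := by linarith
    have := stepQ (d := 2*j) (q := q) (e := f) (t := t) (hL.mono (by omega)) (by omega) (by
      rcases Nat.eq_zero_or_pos j with rfl | hj
      · omega
      · have : 4 * (q + t) ≤ 3*j+11 := by omega
        clear * - this hb hj
        nlinarith)
    rw [show 1 + r = f + t by omega]; exact this

lemma main4 (d : ℕ) : Main 4 d := by
  induction d using Nat.twoStepInduction with
  | zero => exact Main.zero 4
  | one => exact Main.one 4
  | more D h0 h1 =>
    refine Main.step (by omega) h0 h1 fun s' q hq e => ⟨numN2 (m := 2) le_rfl hq e, fun s i1 i2 => ?_⟩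
    rcases Nat.even_or_odd' D with ⟨j, rfl | rfl⟩
    · exact step4_even hq e i1 i2
    · exact step4_odd hq e i1 i2

end PL

set_option autoImplicit false
namespace PL
open Module Submodule
open scoped Polynomial Pointwise

lemma choose3 (d : ℕ) : 6 * (d+3).choose 3 = (d+3)*(d+2)*(d+1) := by
  have := Nat.descFactorial_eq_factorial_mul_choose (d+3) 3
  simp [Nat.descFactorial, Nat.factorial] at this
  linarith

lemma choose5 (d : ℕ) : 120 * (d+5).choose 5 = (d+5)*((d+4)*(d+3)*(d+2)*(d+1)) := by
  have := Nat.descFactorial_eq_factorial_mul_choose (d+5) 5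
  simp [Nat.descFactorial, Nat.factorial] at this
  linarith

lemma choose6 (d : ℕ) : 720 * (d+6).choose 6 = (d+6)*((d+5)*((d+4)*(d+3)*(d+2)*(d+1))) := by
  have := Nat.descFactorial_eq_factorial_mul_choose (d+6) 6
  simp [Nat.descFactorial, Nat.factorial] at this
  linarith

/-- Pure arithmetic core over the rationals. -/
lemma arithQ {d n h q ρ s s' C E Le : ℚ} (hd : 2 ≤ d) (hn : 5 ≤ n) (hq0 : 0 ≤ q) (hq : q ≤ d - 1) (hρ : q = ρ * d)
    (r1 : n * h = C + E) (r2 : (n-1) * E = d * C) (e : h = (d+1)/2 + s' + ρ)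
    (i1 : d * h + n * h ≤ (d+2)*(d+1)/2 + s*(d+1) + d)
    (i2 : (d+2)*(d+1)/2 + s*(d+1) ≤ d * h + n * h + d)
    (hLe : E + 1 ≤ (d+1)*d/2 + Le*d) (hh : d^2+4*d+1 ≤ 2*h)
    (hC : (d+3)*(d+2)*(d+1) ≤ 6 * C) (hE : (d+3)*(d+2)*(d+1)*d ≤ 24 * E) :
    2 * q < s - s' + 1 ∧ q ≤ Le ∧ q * (d+1) + (s - s' + 1 - 2*q) ≤ C ∧
    (s - s' + 1) * (d+1) ≤ C + q + d * Le ∧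
    (d+1) * (s - s' + 1) < (n-1)*h + (3*d+1)/2 + d := by
  have hd0 : 0 < d := by linarith
  have ρ0 : 0 ≤ ρ := by
    by_contra hc
    push Not at hc
    nlinarith
  have ρ1 : ρ < 1 := by
    by_contra hc
    push Not at hc
    nlinarith
  have u : (d+1) * (s - s' + 1) ≤ (n-1)*h + (3*d+1)/2 + q + ρ := by
    have : s' = h - (d+1)/2 - ρ := by linarith
    subst this
    rw [hρ]
    linarith
  have l : (n-1)*h + (1-d)/2 + q + ρ ≤ (d+1) * (s - s' + 1) := by
    have : s' = h - (d+1)/2 - ρ := by linarith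
    subst this
    rw [hρ]
    linarith
  have W : (n-1) * h = C + E - h := by linarith
  have hpos : 0 < h := by nlinarith
  have W4 : 4 * h ≤ (n-1) * h := by nlinarith
  have C0 : 0 < C := by
    have : 0 < (d+3)*(d+2)*(d+1) := by positivity
    linarith
  have E0 : 0 < E := by
    have : 0 < (d+3)*(d+2)*(d+1)*d := by positivity
    linarith
  have E4 : 4 * E ≤ d * C := by nlinarith
  refine ⟨?_, ?_, ?_, ?_, ?_⟩
  · have : (d+1) * (2*q) < (d+1) * (s - s' + 1) := by
      have : q * (2 * d + 1) ≤ (d-1)*(2*d+1) := by gcongr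
      nlinarith
    exact lt_of_mul_lt_mul_left this (by linarith)
  · have : q * d ≤ Le * d := by
      have : q * d ≤ (d-1)*d := by gcongr
      have : 0 ≤ d * (d^3+6*d^2-25*d+18) := by
        have : 0 ≤ d^3+6*d^2-25*d+18 := by nlinarith [sq_nonneg (d-2), mul_nonneg (sub_nonneg.2 hd) (sq_nonneg (d-2))]
        positivity
      nlinarith
    exact le_of_mul_le_mul_right this hd0
  · have : (d+1) * (q * (d+1) + (s - s' + 1 - 2*q)) ≤ (d+1) * C := by
      have a1 : q * d^2 ≤ (d-1)*d^2 := by gcongr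
      have a2 : d * ((d+3)*(d+2)*(d+1)) ≤ d * (6*C) := by gcongr
      have a3 : 0 ≤ d^4-2*d^3+19*d^2-6*d-12 := by
        have : 0 ≤ d^3 * (d-2) := by have := sub_nonneg.2 hd; positivity
        nlinarith
      linarith
    exact le_of_mul_le_mul_left this (by linarith)
  · linarith
  · have : q + ρ < d := by linarith
    linarith

/-- The generic step. -/
lemma stepGen {m D s' q s Le Lt : ℕ} (hm : 3 ≤ m) (hq : q < D+2)
    (e : (D+1+(m+2)).choose (m+2) = (D+3).choose 2 + s'*(D+2) + q)
    (i1 : (D+2+(m+2)).choose (m+2) ≤ (D+4).choose 2 + s*(D+3) + (D+2))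
    (i2 : (D+4).choose 2 + s*(D+3) ≤ (D+2+(m+2)).choose (m+2) + (D+2))
    (h1 : LL (m+2) (D+1) Le) (h2 : LL (m+1) (D+2) Lt)
    (hLe : (D+1+(m+1)).choose (m+1) + 1 ≤ (D+3).choose 2 + Le*(D+2))
    (hLt : q ≤ Lt)
    (hh : (D+2) * ((D+2)^2+4*(D+2)+1) ≤ 2 * (D+1+(m+2)).choose (m+2))
    (hK2 : ∀ k, 2*(D+3)*(D+2)*k < 2*(m+1) * (D+1+(m+2)).choose (m+2) + (D+2)*(5*(D+2)+1) → k ≤ Le + Lt) :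
    ∃ r, s = s' + r + (q+q) ∧ GG (m+2) (D+2) (1+r) q := by
  obtain ⟨r1, r2, r3, r4, r5⟩ := rel_all m D
  have t1 := two_choose (D+1)
  have t2 := two_choose (D+2)
  have c3 : (D+2+3).choose 3 ≤ (D+2+m).choose m := choose_mono_n hm
  have c4 : (D+1+4).choose 4 ≤ (D+1+(m+1)).choose (m+1) := choose_mono_n (by omega)
  have c3' := choose3 (D+2)
  have c4' := choose4 (D+1)
  rw [show D+1+2 = D+3 by ring] at t1
  rw [show D+2+2 = D+4 by ring] at t2
  have core := @coreG m D q
  generalize (D+2+(m+2)).choose (m+2) = N at *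
  generalize (D+2+(m+1)).choose (m+1) = H at *
  generalize (D+1+(m+1)).choose (m+1) = E at *
  generalize (D+2+m).choose m = C at *
  generalize (D+1+(m+2)).choose (m+2) = G at *
  generalize (D+(m+2)).choose (m+2) = G0 at *
  generalize (D+3).choose 2 = A at *
  generalize (D+4).choose 2 = B at *
  generalize (D+2+3).choose 3 = c at *
  generalize (D+1+4).choose 4 = f at *
  subst r1 r2
  have hd0 : (0:ℚ) < D + 2 := by positivity
  have hA : (A:ℚ) = (D+3)*(D+2)/2 := by
    have : (2:ℚ) * A = (D+1+2) * (D+1+1) := by exact_mod_cast t1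
    linarith
  have hB : (B:ℚ) = (D+4)*(D+3)/2 := by
    have : (2:ℚ) * B = (D+2+2) * (D+2+1) := by exact_mod_cast t2
    linarith
  have hG : (D+2:ℚ) * (G/(D+2)) = G := by field_simp
  have hr4 : ((m:ℚ)+2) * G = (D+2) * (C+E) := by exact_mod_cast r4
  have hr5 : ((m:ℚ)+1) * E = (D+2) * C := by exact_mod_cast r5
  have he : (G:ℚ) = A + s' * (D+2) + q := by exact_mod_cast e
  have key := arithQ (d := (D:ℚ)+2) (n := m+2) (h := G/(D+2)) (q := q) (ρ := q/(D+2)) (s := s) (s' := s') (C := C)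
    (E := E) (Le := Le) (by linarith [(Nat.cast_nonneg D : (0:ℚ) ≤ D)])
    (by have : (3:ℚ) ≤ m := by exact_mod_cast hm
        linarith) (Nat.cast_nonneg q)
    (by have : (q:ℚ) + 1 ≤ D + 2 := by exact_mod_cast hq
        linarith) (by field_simp) (by field_simp; linarith) (by linarith)
    (by rw [he, hA]; field_simp; ring)
    (by
      have h3 : ((m:ℚ)+2) * (G/(D+2)) = C+E := by field_simp; linarith
      rw [hG, h3]
      have : ((G + (C+E) : ℕ):ℚ) ≤ ((B + s*(D+3)+(D+2) : ℕ) : ℚ) := by exact_mod_cast i1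
      push_cast at this
      rw [hB] at this
      linarith)
    (by
      have h3 : ((m:ℚ)+2) * (G/(D+2)) = C+E := by field_simp; linarith
      rw [hG, h3]
      have : ((B + s*(D+3) : ℕ):ℚ) ≤ ((G + (C+E)+(D+2) : ℕ) : ℚ) := by exact_mod_cast i2
      push_cast at this
      rw [hB] at this
      linarith)
    (by
      have : ((E + 1 : ℕ):ℚ) ≤ ((A + Le*(D+2) : ℕ) : ℚ) := by exact_mod_cast hLe
      push_cast at this
      rw [hA] at this
      linarith)
    (by
      have : ((D:ℚ)+2) * ((D+2)^2+4*(D+2)+1) ≤ 2 * G := by exact_mod_cast hh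
      rw [← hG] at this
      refine le_of_mul_le_mul_left ?_ hd0
      linarith)
    (by
      have h3 : (c:ℚ) ≤ C := by exact_mod_cast c3
      have h4 : (6:ℚ) * c = (D+2+3)*(D+2+2)*(D+2+1) := by exact_mod_cast c3'
      linarith)
    (by
      have h3 : (f:ℚ) ≤ E := by exact_mod_cast c4
      have h4 : (24:ℚ) * f = (D+1+4)*(D+1+3)*(D+1+2)*(D+1+1) := by exact_mod_cast c4'
      linarith)
  obtain ⟨k1, k2, k3, k4, k5⟩ := key
  have hs : s' + 2 * q ≤ s := by
    have : (s' + 2 * q : ℚ) < s + 1 := by linarith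
    have : s' + 2 * q < s + 1 := by exact_mod_cast this
    omega
  obtain ⟨r, rfl⟩ := Nat.exists_eq_add_of_le hs
  refine ⟨r, by ring, ?_⟩
  push_cast at k2 k3 k4 k5
  refine core h1 h2 (by exact_mod_cast k2) hLt ?_ ?_ ?_
  · have : (q:ℚ) * (D+3) + (1+r) ≤ C := by linarith
    exact_mod_cast this
  · apply hK2
    have : (2:ℚ)*(D+3)*(D+2)*(1+r+2*q) < 2*(m+1) * G + (D+2)*(5*(D+2)+1) := by
      have := mul_lt_mul_of_pos_left k5 hd0
      have h6 : ((m:ℚ)+1) * G = (D+2) * (((m:ℚ)+2-1) * (G/(D+2))) := by field_simp; ring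
      rw [mul_assoc 2 ((m:ℚ)+1), h6]
      linarith
    exact_mod_cast this
  · have : ((1:ℚ)+r+2*q)*(D+3) ≤ C + q + (D+2) * Le := by linarith
    exact_mod_cast this

lemma K2gen {m D Le Lt : ℕ}
    (hLe : (D+1+(m+1)).choose (m+1) + 1 ≤ (D+3).choose 2 + Le*(D+2))
    (hLt : (D+2+m).choose m + 1 ≤ (D+4).choose 2 + Lt*(D+3))
    (hX : (D+2)*(2*(D+2)^2+7*(D+2)) ≤ 2 * (D+1+(m+2)).choose (m+2) + 2*(D+2)*Le + 3 * (D+2)) :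
    ∀ k, 2*(D+3)*(D+2)*k < 2*(m+1) * (D+1+(m+2)).choose (m+2) + (D+2)*(5*(D+2)+1) → k ≤ Le + Lt := by
  intro k hk
  obtain ⟨r1, r2, r3, r4, r5⟩ := rel_all m D
  have t1 := two_choose (D+1)
  have t2 := two_choose (D+2)
  rw [show D+1+2 = D+3 by ring] at t1
  rw [show D+2+2 = D+4 by ring] at t2
  generalize (D+2+(m+1)).choose (m+1) = H at *
  generalize (D+1+(m+1)).choose (m+1) = E at *
  generalize (D+2+m).choose m = C at *
  generalize (D+1+(m+2)).choose (m+2) = G at *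
  generalize (D+3).choose 2 = A at *
  generalize (D+4).choose 2 = B at *
  by_contra hc
  push Not at hc
  have a1 : 2*(D+3)*(D+2)*(Le+Lt+1) ≤ 2*(D+3)*(D+2)*k := Nat.mul_le_mul_left _ hc
  have a2 := Nat.mul_le_mul_left (2*(D+2)) hLe
  have a3 := Nat.mul_le_mul_left (2*(D+2)) hLt
  have a4 : (D+2) * (2 * A) = (D+2) * ((D+1+2)*(D+1+1)) := by rw [t1]
  have a5 : (D+2) * (2 * B) = (D+2) * ((D+2+2)*(D+2+1)) := by rw [t2]
  subst r2
  clear * - a1 a2 a3 a4 a5 hk hX r4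
  nlinarith

end PL

set_option autoImplicit false
namespace PL
open Module Submodule
open scoped Polynomial Pointwise

lemma be_ge (d : ℕ) : d^2+6*d+8 ≤ 8 * be d := by
  rcases Nat.even_or_odd' d with ⟨j, rfl | rfl⟩
  · have := be_even j
    nlinarith
  · have := be_odd j
    nlinarith

/-- `n ≥ 6` and the generic estimates hold. -/
lemma stepHigh {m D s' q s Le Lt : ℕ} (hm : 4 ≤ m) (hq : q < D+2)
    (e : (D+1+(m+2)).choose (m+2) = (D+3).choose 2 + s'*(D+2) + q)
    (i1 : (D+2+(m+2)).choose (m+2) ≤ (D+4).choose 2 + s*(D+3) + (D+2))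
    (i2 : (D+4).choose 2 + s*(D+3) ≤ (D+2+(m+2)).choose (m+2) + (D+2))
    (h1 : LL (m+2) (D+1) Le) (h2 : LL (m+1) (D+2) Lt)
    (hLe : (D+1+(m+1)).choose (m+1) + 1 ≤ (D+3).choose 2 + Le*(D+2))
    (hLt : (D+2+m).choose m + 1 ≤ (D+4).choose 2 + Lt*(D+3))
    (hh : (D+2) * ((D+2)^2+4*(D+2)+1) ≤ 2 * (D+1+(m+2)).choose (m+2))
    (hX : (D+2)*(2*(D+2)^2+7*(D+2)) ≤ 2 * (D+1+(m+2)).choose (m+2) + 2*(D+2)*Le + 3 * (D+2)) :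
    ∃ r, s = s' + r + (q+q) ∧ GG (m+2) (D+2) (1+r) q := by
  refine stepGen (by omega) hq e i1 i2 h1 h2 hLe ?_ hh (K2gen hLe hLt hX)
  have c4 : (D+2+4).choose 4 ≤ (D+2+m).choose m := choose_mono_n hm
  have c4' := choose4 (D+2)
  have t2 := two_choose (D+2)
  rw [show D+2+2 = D+4 by ring] at t2
  generalize (D+2+m).choose m = C at *
  generalize (D+4).choose 2 = B at *
  generalize (D+2+4).choose 4 = f at *
  by_contra hc
  push Not at hc
  have h3 : (Lt + 1) * (D+3) ≤ (D+1) * (D+3) := Nat.mul_le_mul_right _ (by omega)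
  clear * - c4 c4' t2 h3 hLt
  have : 24 * f + 24 ≤ 12 * ((D+2+2)*(D+2+1)) + 24 * (D * (D+3)) := by nlinarith
  rw [c4'] at this
  ring_nf at this
  nlinarith

lemma hh5 {m D : ℕ} (hm : 3 ≤ m) (hD : 3 ≤ D) :
    (D+2) * ((D+2)^2+4*(D+2)+1) ≤ 2 * (D+1+(m+2)).choose (m+2) := by
  have c : (D+1+5).choose 5 ≤ (D+1+(m+2)).choose (m+2) := choose_mono_n (by omega)
  have c' := choose5 (D+1)
  obtain ⟨x, rfl⟩ := Nat.exists_eq_add_of_le hD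
  refine le_trans ?_ (Nat.mul_le_mul_left 2 c)
  have : 60 * ((3+x+2) * ((3+x+2)^2+4*(3+x+2)+1)) ≤ 60 * (2 * (3+x+1+5).choose 5) := by
    rw [← mul_assoc 60 2, show 60*2 = 120 from rfl, c']
    ring_nf
    nlinarith [Nat.zero_le (x^5), Nat.zero_le (x^4), Nat.zero_le (x^3), Nat.zero_le (x^2)]
  omega

lemma hX6 {m D : ℕ} (hm : 4 ≤ m) (hD : 3 ≤ D) :
    (D+2)*(2*(D+2)^2+7*(D+2)) ≤ 2 * (D+1+(m+2)).choose (m+2) + 3 * (D+2) := by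
  have c : (D+1+6).choose 6 ≤ (D+1+(m+2)).choose (m+2) := choose_mono_n (by omega)
  have c' := choose6 (D+1)
  obtain ⟨x, rfl⟩ := Nat.exists_eq_add_of_le hD
  have : 360 * ((3+x+2)*(2*(3+x+2)^2+7*(3+x+2))) ≤ 720 * (3+x+1+6).choose 6 + 360 * (3*(3+x+2)) := by
    rw [c']
    ring_nf
    nlinarith [Nat.zero_le (x^6), Nat.zero_le (x^5), Nat.zero_le (x^4), Nat.zero_le (x^3), Nat.zero_le (x^2)]
  omega

lemma K2five {D Le : ℕ} (hD : 3 ≤ D)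
    (hLe : (D+1+4).choose 4 + 1 ≤ (D+3).choose 2 + Le*(D+2)) :
    ∀ k, 2*(D+3)*(D+2)*k < 2*(3+1) * (D+1+5).choose 5 + (D+2)*(5*(D+2)+1) → k ≤ Le + be (D+2) := by
  intro k hk
  have c4 := choose4 (D+1)
  have c5 := choose5 (D+1)
  have t1 := two_choose (D+1)
  rw [show D+1+2 = D+3 by ring] at t1
  have hb := be_ge (D+2)
  by_contra hc
  push Not at hc
  generalize (D+1+4).choose 4 = E at *
  generalize (D+1+5).choose 5 = G at *
  generalize (D+3).choose 2 = A at *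
  generalize be (D+2) = b at *
  obtain ⟨x, rfl⟩ := Nat.exists_eq_add_of_le hD
  have a1 : 2*(3+x+3)*(3+x+2)*(Le+b+1) ≤ 2*(3+x+3)*(3+x+2)*k := Nat.mul_le_mul_left _ hc
  have a2 := Nat.mul_le_mul_left (120*(3+x+3)) hLe
  have a3 := Nat.mul_le_mul_left (15*(3+x+3)*(3+x+2)) hb
  have a4 : (3+x+3) * (24 * E) = (3+x+3) * ((3+x+1+4)*(3+x+1+3)*(3+x+1+2)*(3+x+1+1)) := by rw [c4]
  have a5 : (3+x+3) * (2 * A) = (3+x+3) * ((3+x+3)*(3+x+1+1)) := by rw [t1]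
  clear hc hLe hb c4 t1 hD
  zify at *
  have : (0:ℤ) ≤ x^5 := by positivity
  have : (0:ℤ) ≤ x^4 := by positivity
  have : (0:ℤ) ≤ x^3 := by positivity
  have : (0:ℤ) ≤ x^2 := by positivity
  have : (0:ℤ) ≤ x := by positivity
  nlinarith

lemma choose_two' (m : ℕ) : (2+m).choose m = (m+2).choose 2 := by
  rw [add_comm, Nat.choose_symm_add]

/-- degree two, `n ≥ 8`. -/
lemma step2 {m s' q s Lt : ℕ} (hm : 6 ≤ m) (hq : q < 2)
    (e : (1+(m+2)).choose (m+2) = 3 + s'*2 + q)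
    (i1 : (2+(m+2)).choose (m+2) ≤ 6 + s*3 + 2)
    (i2 : 6 + s*3 ≤ (2+(m+2)).choose (m+2) + 2)
    (h2 : LL (m+1) 2 Lt)
    (hLt : (2+m).choose m + 1 ≤ 6 + Lt*3) :
    ∃ r, s = s' + r + (q+q) ∧ GG (m+2) 2 (1+r) q := by
  have c1 : (1+(m+2)).choose (m+2) = m+3 := by
    rw [add_comm, Nat.choose_succ_self_right]
  have hL : LL (m+2) 1 ((m+2)/2) := LL.fill1 (m+1) _ (by omega)
  have core := @coreG m 0 q
  have t1 := two_choose m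
  have t2 := two_choose (m+2)
  rw [choose_two'] at i1 i2 hLt
  simp only [zero_add] at core
  rw [choose_two'] at core
  have hC : 7 * (m+2) ≤ 2 * (m+2).choose 2 := by rw [t1]; nlinarith
  have hN : (m+2+2).choose 2 = (m+2).choose 2 + 2*(m+2) + 1 := by nlinarith
  rw [hN] at i1 i2
  generalize (m+2).choose 2 = C at *
  rw [c1] at e
  have hs : s' + 2 * q ≤ s := by omega
  obtain ⟨r, rfl⟩ := Nat.exists_eq_add_of_le hs
  exact ⟨r, by ring, core hL h2 (by omega) (by omega) (by omega) (by omega) (by omega)⟩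

/-- explicit small cases -/
lemma stepSmall {m D s' q s Le Lt C : ℕ} (hC : (D+2+m).choose m = C)
    (h1 : LL (m+2) (D+1) Le) (h2 : LL (m+1) (D+2) Lt)
    (hs : s' + 2 * q ≤ s)
    (K0 : q ≤ Le) (K0' : q ≤ Lt)
    (Ka : q * (D+3) + (1 + (s - s' - 2*q)) ≤ C)
    (K2 : 1 + (s - s') ≤ Le + Lt)
    (K : (1 + (s - s')) * (D+3) ≤ C + q + (D+2) * Le) :
    ∃ r, s = s' + r + (q+q) ∧ GG (m+2) (D+2) (1+r) q := by
  obtain ⟨r, rfl⟩ := Nat.exists_eq_add_of_le hs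
  rw [show s' + 2*q + r - s' - 2*q = r by omega] at Ka
  rw [show s' + 2*q + r - s' = r + 2*q by omega, ← add_assoc] at K2 K
  subst hC
  exact ⟨r, by ring, coreG h1 h2 K0 K0' Ka K2 K⟩

end PL

set_option autoImplicit false
namespace PL
open Module Submodule
open scoped Polynomial Pointwise

lemma cv : Nat.choose 6 5 = 6 ∧ Nat.choose 7 6 = 7 ∧ Nat.choose 8 7 = 8 ∧ Nat.choose 7 5 = 21 ∧ Nat.choose 8 6 = 28 ∧
    Nat.choose 9 7 = 36 ∧ Nat.choose 8 5 = 56 ∧ Nat.choose 9 6 = 84 ∧ Nat.choose 9 5 = 126 ∧ Nat.choose 3 2 = 3 ∧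
    Nat.choose 4 2 = 6 ∧ Nat.choose 5 2 = 10 ∧ Nat.choose 6 2 = 15 ∧ Nat.choose 6 4 = 15 ∧ Nat.choose 7 4 = 35 ∧
    Nat.choose 5 3 = 10 ∧ Nat.choose 6 3 = 20 ∧ Nat.choose 7 3 = 35 ∧ Nat.choose 5 4 = 5 := by decide

lemma stepAll {m D s' q s : ℕ} (hm : 3 ≤ m) (ih : ∀ n', 4 ≤ n' → n' < m + 2 → ∀ d, Main n' d) (hq : q < D+2)
    (e : (D+1+(m+2)).choose (m+2) = (D+3).choose 2 + s'*(D+2) + q)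
    (i1 : (D+2+(m+2)).choose (m+2) ≤ (D+4).choose 2 + s*(D+3) + (D+2))
    (i2 : (D+4).choose 2 + s*(D+3) ≤ (D+2+(m+2)).choose (m+2) + (D+2)) :
    ∃ r, s = s' + r + (q+q) ∧ GG (m+2) (D+2) (1+r) q := by
  obtain ⟨Le, h1, hLe⟩ := Main.LL (by omega) (ih (m+1) (by omega) (by omega) (D+1))
  have hb2 : be 2 = 3 := rfl
  have hb3 : be 3 = 5 := rfl
  have hb4 : be 4 = 6 := rfl
  obtain ⟨v1,v2,v3,v4,v5,v6,v7,v8,v9,v10,v11,v12,v13,v14,v15,v16,v17,v18,v19⟩ := cv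
  rcases Nat.eq_or_lt_of_le hm with rfl | hm4
  · have h2 := LL4' (D+2)
    rcases Nat.lt_or_ge D 3 with hD | hD
    · interval_cases D
      · simp only [Nat.reduceAdd] at *
        exact stepSmall (D := 0) (m := 3) v16 h1 h2 (by omega) (by omega) (by omega) (by omega) (by omega) (by omega)
      · simp only [Nat.reduceAdd] at *
        exact stepSmall (D := 1) (m := 3) v17 h1 h2 (by omega) (by omega) (by omega) (by omega) (by omega) (by omega)
      · simp only [Nat.reduceAdd] at *
        exact stepSmall (D := 2) (m := 3) v18 h1 h2 (by omega) (by omega) (by omega) (by omega) (by omega) (by omega)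
    · refine stepGen le_rfl hq e i1 i2 h1 h2 hLe ?_ (hh5 le_rfl hD) (K2five hD hLe)
      have := be_ge (D+2)
      nlinarith
  obtain ⟨Lt, h2, hLt⟩ := Main.LL (by omega) (ih m hm4 (by omega) (D+2))
  rcases Nat.lt_or_ge D 3 with hD | hD
  · interval_cases D
    · rcases Nat.lt_or_ge m 6 with hm6 | hm6
      · have h1' : LL (m+2) 1 ((m+2)/2) := LL.fill1 (m+1) _ (by omega)
        interval_cases m
        · simp only [Nat.reduceAdd] at *
          exact stepSmall (D := 0) (m := 4) v14 h1' h2 (by omega) (by omega) (by omega) (by omega) (by omega) (by omega)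
        · simp only [Nat.reduceAdd] at *
          exact stepSmall (D := 0) (m := 5) v4 h1' h2 (by omega) (by omega) (by omega) (by omega) (by omega) (by omega)
      · simp only [Nat.reduceAdd, v10, v11] at *
        exact step2 hm6 hq e i1 i2 h2 hLt
    · rcases Nat.lt_or_ge m 5 with hm6 | hm6
      · obtain rfl : m = 4 := by omega
        simp only [Nat.reduceAdd] at *
        exact stepSmall (D := 1) (m := 4) v15 h1 h2 (by omega) (by omega) (by omega) (by omega) (by omega) (by omega)
      · have g : (2+7).choose 7 ≤ (2+(m+2)).choose (m+2) := choose_mono_n (by omega)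
        have g' : (2+6).choose 6 ≤ (2+(m+1)).choose (m+1) := choose_mono_n (by omega)
        simp only [Nat.reduceAdd] at g g'
        refine stepHigh (D := 1) hm4 hq e i1 i2 h1 h2 hLe hLt ?_ ?_ <;> simp only [Nat.reduceAdd] at * <;> omega
    · have g : (3+6).choose 6 ≤ (3+(m+2)).choose (m+2) := choose_mono_n (by omega)
      have g' : (3+5).choose 5 ≤ (3+(m+1)).choose (m+1) := choose_mono_n (by omega)
      simp only [Nat.reduceAdd] at g g'
      refine stepHigh (D := 2) hm4 hq e i1 i2 h1 h2 hLe hLt ?_ ?_ <;> simp only [Nat.reduceAdd] at * <;> omega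
  · refine stepHigh hm4 hq e i1 i2 h1 h2 hLe hLt (hh5 hm hD) ?_
    have := hX6 hm4 hD
    omega

lemma mainAll (n : ℕ) (hn : 4 ≤ n) : ∀ d, Main n d := by
  induction n using Nat.strong_induction_on with
  | _ n ih =>
    rcases Nat.eq_or_lt_of_le hn with rfl | hn5
    · exact main4
    · obtain ⟨m, rfl⟩ := Nat.exists_eq_add_of_le' (show 2 ≤ n by omega)
      intro d
      induction d using Nat.twoStepInduction with
      | zero => exact Main.zero _
      | one => exact Main.one _
      | more D h0 h1 =>
        exact Main.step (by omega) h0 h1 fun s' q hq e => ⟨numN2 (by omega) hq e, fun s i1 i2 =>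
          stepAll (by omega) (fun n' a b => ih n' b a) hq e i1 i2⟩

end PL

/-- Polynomial decomposition: if `C(d+n,n) ≤ C(d+2,2) + s(d+1)` (with `n ≥ 4`,
`d ≥ 1`), there are linear forms `a, b, c` and `l_i, m_i` (`i = 1,…,s`) such that
every degree-`d` form `f` in `n+1` variables can be written as
`f = f₁(l₁,m₁) + ⋯ + f_s(l_s,m_s) + g(a,b,c)` with the `fᵢ` binary forms and `g`
a ternary form of degree `d`. -/
theorem stmt16 (n d s : ℕ) (hn : 4 ≤ n) (hd : 1 ≤ d)
    (h : (d+n).choose n ≤ (d+2).choose 2 + s * (d+1)) :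
    ∃ (a b c : MvPolynomial (Fin (n+1)) ℂ)
      (l m : Fin s → MvPolynomial (Fin (n+1)) ℂ),
      a.IsHomogeneous 1 ∧ b.IsHomogeneous 1 ∧ c.IsHomogeneous 1 ∧
      (∀ i, (l i).IsHomogeneous 1) ∧ (∀ i, (m i).IsHomogeneous 1) ∧
      ∀ f : MvPolynomial (Fin (n+1)) ℂ, f.IsHomogeneous d →
        ∃ (F : Fin s → MvPolynomial (Fin 2) ℂ) (G : MvPolynomial (Fin 3) ℂ),
          (∀ i, (F i).IsHomogeneous d) ∧ G.IsHomogeneous d ∧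
          f = (∑ i, MvPolynomial.aeval ![l i, m i] (F i))
              + MvPolynomial.aeval ![a, b, c] G := by
  exact PL.Main.final (by omega) (PL.mainAll n hn d) h
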